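/- Let c, d be positive integers and let λ, μ be partitions such that all parts of cλ + dμ are divisible by c + d, i.e., ν := (cλ + dμ)/(c+d) is a partition. Then (s_ν)^{c+d} − (s_λ)^c (s_μ)^d is Schur nonnegative (Schur log-concavity of the map λ ↦ s_λ). -/

import Mathlib

/-- The complete homogeneous symmetric function `h_m` in `N` variables,
with `h_m = 0` for `m < 0`. -/
noncomputable def homog (N : ℕ) (m : ℤ) : MvPolynomial (Fin N) ℤ :=
  if 0 ≤ m then MvPolynomial.hsymm (Fin N) ℤ m.toNat else 0

/-- The skew Schur polynomial `s_{λ/μ}` in `N` variables, given by the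
Jacobi–Trudi determinant `det (h_{λ_i - μ_j - i + j})_{i,j=1}^k`, where the
partitions `lam`, `mu` are recorded 0-indexed (`lam 0 = λ_1`). -/
noncomputable def skewSchur (N k : ℕ) (lam mu : ℕ → ℕ) : MvPolynomial (Fin N) ℤ :=
  Matrix.det (Matrix.of fun i j : Fin k =>
    homog N ((lam i : ℤ) - (mu j : ℤ) - (i : ℤ) + (j : ℤ)))

/-- A symmetric polynomial is Schur nonnegative if it is a linear combination
with nonnegative coefficients of Schur polynomials `s_λ`. -/
def IsSchurNonneg (N : ℕ) (f : MvPolynomial (Fin N) ℤ) : Prop :=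
  ∃ (m : ℕ) (c : Fin m → ℕ) (k : Fin m → ℕ) (lam : Fin m → ℕ → ℕ),
    (∀ i, Antitone (lam i)) ∧ (∀ i j, k i ≤ j → lam i j = 0) ∧
    f = ∑ i, (c i : ℤ) • skewSchur N (k i) (lam i) (fun _ => 0)


namespace SLC
open Finset

/-- Gelfand-Tsetlin style patterns: `G q l` is the number of cells of row `q` with letter `< l`. -/
structure IsGT (p N : ℕ) (inn out : ℕ → ℕ) (G : ℕ → ℕ → ℕ) : Prop where
  zero : ∀ q, G q 0 = inn q
  top : ∀ q l, N ≤ l → G q l = out q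
  mono : ∀ q l, G q l ≤ G q (l+1)
  inter : ∀ q l, G (q+p) (l+1) ≤ G q l

lemma IsGT.mono' {p N inn out G} (h : IsGT p N inn out G) (q : ℕ) : Monotone (G q) :=
  monotone_nat_of_le_succ (h.mono q)

lemma IsGT.le_out {p N inn out G} (h : IsGT p N inn out G) (q l : ℕ) : G q l ≤ out q := by
  rw [← h.top q (max N l) (le_max_left _ _)]
  exact h.mono' q (le_max_right _ _)

lemma IsGT.row_zero {p N inn out G} (h : IsGT p N inn out G) {q : ℕ} (hq : out q = 0) (l : ℕ) :
    G q l = 0 := by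
  have := h.le_out q l
  omega

lemma isGT_finite (p N : ℕ) (inn out : ℕ → ℕ) (K : ℕ) (hK : ∀ q, K ≤ q → out q = 0) :
    {G | IsGT p N inn out G}.Finite := by
  let B := ∑ q ∈ range K, out q
  let F : (ℕ → ℕ → ℕ) → (Fin K → Fin N → Fin (B+1)) :=
    fun G q l => if h : G q l < B + 1 then ⟨G q l, h⟩ else 0
  refine Set.Finite.of_finite_image (f := F) (Set.toFinite _) ?_
  intro G hG G' hG' h
  funext q l
  by_cases hl : N ≤ l
  · rw [IsGT.top hG q l hl, IsGT.top hG' q l hl]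
  by_cases hq : K ≤ q
  · rw [IsGT.row_zero hG (hK q hq), IsGT.row_zero hG' (hK q hq)]
  have h1 := congrFun (congrFun h ⟨q, by omega⟩) ⟨l, by omega⟩
  have hB : out q ≤ B := Finset.single_le_sum (f := out) (fun _ _ => Nat.zero_le _) (by simp; omega)
  have h2 : G q l < B + 1 := by have := IsGT.le_out hG q l; omega
  have h3 : G' q l < B + 1 := by have := IsGT.le_out hG' q l; omega
  simp only [F, h2, h3, dif_pos] at h1
  simpa using h1

lemma IsGT.inter' {N inn out G} (h : IsGT 2 N inn out G) {q r : ℕ} (l : ℕ) (hqr : q + 2 ≤ r)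
    (hp : r % 2 = q % 2) : G r (l+1) ≤ G q l := by
  obtain ⟨m, rfl⟩ : ∃ m, r = q + 2 * m + 2 := ⟨(r - q - 2)/2, by omega⟩
  clear hqr hp
  induction m with
  | zero => exact h.inter q l
  | succ m ih =>
    refine le_trans ?_ ih
    refine le_trans ?_ (h.mono _ l)
    exact h.inter (q + 2 * m + 2) l

lemma IsGT.inter'' {N inn out G} (h : IsGT 2 N inn out G) {q r : ℕ} (l : ℕ) (hqr : q ≤ r)
    (hp : r % 2 = q % 2) : G r l ≤ G q l := by
  rcases Nat.lt_or_ge q r with h1 | h1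
  · exact le_trans (h.mono _ _) (h.inter' l (by omega) hp)
  · have : q = r := by omega
    rw [this]

lemma IsGT.mono2 {p N inn out G} (h : IsGT p N inn out G) (q i : ℕ) :
    G q (i+1) ≤ G q (i+2) := h.mono q (i+1)

lemma IsGT.inter2 {p N inn out G} (h : IsGT p N inn out G) (q i : ℕ) :
    G (q+p) (i+2) ≤ G q (i+1) := h.inter q (i+1)

lemma IsGT.inter2' {N inn out G} (h : IsGT 2 N inn out G) {q r : ℕ} (i : ℕ) (hqr : q + 2 ≤ r)
    (hp : r % 2 = q % 2) : G r (i+2) ≤ G q (i+1) := h.inter' (i+1) hqr hp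

/-- contribution of columns `≥ C` of row `q`: letters `i` minus letters `i+1` -/
def ff (G : ℕ → ℕ → ℕ) (i q C : ℕ) : ℤ :=
  2 * ((G q (i+1) - C : ℕ) : ℤ) - ((G q i - C : ℕ) : ℤ) - ((G q (i+2) - C : ℕ) : ℤ)

def BB (K : ℕ) (G : ℕ → ℕ → ℕ) (i q c : ℕ) : ℤ :=
  ∑ r ∈ range K, ff G i r (if r < q then c else c+1)

def eps (G : ℕ → ℕ → ℕ) (i q c : ℕ) : ℤ := ff G i q c - ff G i q (c+1)

def Good (N K : ℕ) (G : ℕ → ℕ → ℕ) : Prop :=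
  ∀ i, i + 2 ≤ N → ∀ q, q ≤ K → ∀ c, 0 ≤ BB K G i q c

lemma BB_succ (K : ℕ) (G : ℕ → ℕ → ℕ) (i q c : ℕ) (hq : q < K) :
    BB K G i (q+1) c = BB K G i q c + eps G i q c := by
  unfold BB
  rw [← Finset.add_sum_erase _ _ (mem_range.2 hq), ← Finset.add_sum_erase (range K) (fun r => ff G i r (if r < q then c else c+1)) (mem_range.2 hq)]
  have : ∑ x ∈ (range K).erase q, ff G i x (if x < q + 1 then c else c + 1)
    = ∑ x ∈ (range K).erase q, ff G i x (if x < q then c else c + 1) := by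
    apply Finset.sum_congr rfl
    intro x hx
    have hx' : x ≠ q := (Finset.mem_erase.1 hx).1
    have : (x < q + 1) ↔ (x < q) := by omega
    simp only [this]
  rw [this]
  simp [eps]
  ring

lemma BB_wrap (K : ℕ) (G : ℕ → ℕ → ℕ) (i c : ℕ) :
    BB K G i 0 c = BB K G i K (c+1) := by
  unfold BB
  apply Finset.sum_congr rfl
  intro x hx
  have := mem_range.1 hx
  simp [this]

/-- first violation -/
structure FV (N K : ℕ) (G : ℕ → ℕ → ℕ) (i q c : ℕ) : Prop where
  hq : q < K
  hi : i + 2 ≤ N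
  neg : BB K G i (q+1) c < 0
  before : ∀ j, j + 2 ≤ N → ∀ q' ≤ K, ∀ c', (c < c' ∨ c' = c ∧ q' ≤ q) → 0 ≤ BB K G j q' c'

lemma exists_FV {N K : ℕ} {G : ℕ → ℕ → ℕ} (L : ℕ) (hL : ∀ q l, G q l ≤ L)
    (hb : ¬ Good N K G) : ∃ i q c, FV N K G i q c := by
  classical
  have hbig : ∀ i q c, L ≤ c → BB K G i q c = 0 := by
    intro i q c hc
    apply Finset.sum_eq_zero
    intro r hr
    have h1 := hL r i
    have h2 := hL r (i+1)
    have h3 := hL r (i+2)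
    unfold ff
    split_ifs <;> omega
  have hex : ∃ n, ∃ i q c, i + 2 ≤ N ∧ q ≤ K ∧ BB K G i q c < 0 ∧ n = (L - c) * (K+1) + q := by
    unfold Good at hb
    push Not at hb
    obtain ⟨i, hi, q, hq, c, h⟩ := hb
    exact ⟨_, i, q, c, hi, hq, h, rfl⟩
  obtain ⟨i, q, c, hi, hq, hneg, hn⟩ := Nat.find_spec hex
  have hmin := fun m hm => Nat.find_min (m := m) hex hm
  rw [hn] at hmin
  have hcL : c < L := by
    by_contra hc
    rw [hbig i q c (by omega)] at hneg
    omega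
  have before : ∀ j, j + 2 ≤ N → ∀ q' ≤ K, ∀ c', (c < c' ∨ c' = c ∧ q' < q) → 0 ≤ BB K G j q' c' := by
    intro j hj q' hq' c' hc'
    by_contra hneg'
    refine hmin ((L - c') * (K+1) + q') ?_ ⟨j, q', c', hj, hq', by omega, rfl⟩
    rcases hc' with h | ⟨rfl, h⟩
    · have : L - c' + 1 ≤ L - c := by omega
      nlinarith [Nat.mul_le_mul_right (K+1) this]
    · omega
  have hq0 : q ≠ 0 := by
    rintro rfl
    rw [BB_wrap] at hneg
    have := before i hi K le_rfl (c+1) (Or.inl (by omega))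
    omega
  obtain ⟨q, rfl⟩ := Nat.exists_eq_succ_of_ne_zero hq0
  refine ⟨i, q, c, by omega, hi, hneg, ?_⟩
  intro j hj q' hq' c' h
  exact before j hj q' hq' c' (by omega)

lemma eps_ge {G : ℕ → ℕ → ℕ} (i q c : ℕ) (h1 : G q i ≤ G q (i+1)) (h2 : G q (i+1) ≤ G q (i+2)) :
    -1 ≤ eps G i q c := by
  unfold eps ff
  omega

lemma eps_nonneg {G : ℕ → ℕ → ℕ} (i q c : ℕ) (h1 : G q i ≤ G q (i+1)) (h2 : G q (i+1) ≤ G q (i+2))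
    (h : G q (i+2) ≤ c ∨ c < G q (i+1)) :
    0 ≤ eps G i q c := by
  unfold eps ff
  omega

section FVlemmas
variable {N K : ℕ} {inn out : ℕ → ℕ} {G : ℕ → ℕ → ℕ} {i q c : ℕ}

lemma FV.zero (h : FV N K G i q c) (hG : IsGT 2 N inn out G) : BB K G i q c = 0 := by
  have h1 := h.before i h.hi q h.hq.le c (Or.inr ⟨rfl, le_rfl⟩)
  have h2 := h.neg
  rw [BB_succ _ _ _ _ _ h.hq] at h2
  have := eps_ge (G := G) i q c (hG.mono _ _) (hG.mono _ _)
  omega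

lemma FV.eps (h : FV N K G i q c) (hG : IsGT 2 N inn out G) : eps G i q c = -1 := by
  have h1 := h.zero hG
  have h2 := h.neg
  rw [BB_succ _ _ _ _ _ h.hq] at h2
  have := eps_ge (G := G) i q c (hG.mono _ _) (hG.mono _ _)
  omega

lemma FV.le (h : FV N K G i q c) (hG : IsGT 2 N inn out G) : G q (i+1) ≤ c := by
  have := h.eps hG
  have h1 := hG.mono q i
  have h2 := hG.mono2 q i
  unfold SLC.eps ff at this
  omega

lemma FV.lt (h : FV N K G i q c) (hG : IsGT 2 N inn out G) : c < G q (i+2) := by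
  have := h.eps hG
  have h1 := hG.mono q i
  have h2 := hG.mono2 q i
  unfold SLC.eps ff at this
  omega

lemma FV.unique (h : FV N K G i q c) (hG : IsGT 2 N inn out G) {i' q' c' : ℕ}
    (h' : FV N K G i' q' c') : i' = i ∧ q' = q ∧ c' = c := by
  have e1 : ¬ (c < c' ∨ c' = c ∧ q' + 1 ≤ q) := fun e => by
    have := h.before i' h'.hi (q'+1) h'.hq c' e
    have := h'.neg
    omega
  have e2 : ¬ (c' < c ∨ c = c' ∧ q + 1 ≤ q') := fun e => by
    have := h'.before i h.hi (q+1) h.hq c e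
    have := h.neg
    omega
  have hc : c' = c := by omega
  have hq : q' = q := by omega
  subst hc hq
  refine ⟨?_, rfl, rfl⟩
  have a1 := h.le hG
  have a2 := h.lt hG
  have a3 := h'.le hG
  have a4 := h'.lt hG
  have m := hG.mono' q'
  rcases Nat.lt_trichotomy i i' with hh | hh | hh
  · have := m (show i + 2 ≤ i' + 1 by omega)
    omega
  · exact hh.symm
  · have := m (show i' + 2 ≤ i + 1 by omega)
    omega

def CC (q c q' : ℕ) : ℕ := if q' < q + 1 then c else c + 1

lemma claimA (h : FV N K G i q c) (hG : IsGT 2 N inn out G) (q' : ℕ) (hq' : q' < K)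
    (hA : CC q c q' < G q' (i+1)) : CC q c q' ≤ G q' i ∨ CC q c q' ≤ G (q'+2) (i+2) := by
  by_contra hcon
  push Not at hcon
  obtain ⟨ha, hb⟩ := hcon
  have f1 := h.le hG
  have f2 := h.lt hG
  have hne : q' ≠ q := by
    rintro rfl
    simp [CC] at hA
    omega
  have hpar : q' % 2 ≠ q % 2 := by
    intro hp
    rcases Nat.lt_or_gt_of_ne hne with hlt | hlt
    · simp only [CC, show q' < q + 1 by omega, if_true] at hA ha hb
      have := hG.inter'' (i+2) (show q' + 2 ≤ q by omega) (by omega)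
      omega
    · simp only [CC, show ¬ q' < q + 1 by omega, if_false] at hA ha hb
      have := hG.inter2' i (show q + 2 ≤ q' by omega) (by omega)
      have := hG.mono2 q' i
      omega
  have hz := h.zero hG
  rcases Nat.lt_or_gt_of_ne hne with hlt | hlt
  · simp only [CC, show q' < q + 1 by omega, if_true] at hA ha hb
    have h0 := h.before i h.hi q' hq'.le c (Or.inr ⟨rfl, hlt.le⟩)
    have h1 : BB K G i (q'+1) c = BB K G i q' c + eps G i q' c := BB_succ _ _ _ _ _ hq'
    have h2 : eps G i q' c = 1 := by
      have := hG.mono2 q' i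
      unfold eps ff
      omega
    have h3 : BB K G i (q'+1) c ≤ BB K G i q c := by
      unfold BB
      apply Finset.sum_le_sum
      intro r hr
      by_cases hr1 : r < q' + 1
      · simp [hr1, show r < q by omega]
      by_cases hr2 : r < q
      · simp only [hr1, hr2, if_true, if_false]
        have : 0 ≤ eps G i r c := by
          apply eps_nonneg _ _ _ (hG.mono _ _) (hG.mono _ _)
          by_cases hp : r % 2 = q % 2
          · right
            have := hG.inter2' i (show r + 2 ≤ q by omega) hp.symm
            omega
          · left
            have := hG.inter'' (i+2) (show q' + 2 ≤ r by omega) (by omega)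
            omega
        unfold eps at this
        omega
      · simp [hr1, hr2]
    omega
  · simp only [CC, show ¬ q' < q + 1 by omega, if_false] at hA ha hb
    have h0 := h.before i h.hi q' hq'.le (c+1) (Or.inl (by omega))
    have h1 : BB K G i (q'+1) (c+1) = BB K G i q' (c+1) + eps G i q' (c+1) := BB_succ _ _ _ _ _ hq'
    have h2 : eps G i q' (c+1) = 1 := by
      have := hG.mono2 q' i
      unfold eps ff
      omega
    have h3 : BB K G i (q'+1) (c+1) ≤ BB K G i q c := by
      unfold BB
      apply Finset.sum_le_sum
      intro r hr
      by_cases hr1 : r < q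
      · simp only [hr1, show r < q' + 1 by omega, if_true]
        have : 0 ≤ eps G i r c := by
          apply eps_nonneg _ _ _ (hG.mono _ _) (hG.mono _ _)
          right
          by_cases hp : r % 2 = q % 2
          · have := hG.inter2' i (show r + 2 ≤ q by omega) hp.symm
            omega
          · have := hG.inter2' i (show r + 2 ≤ q' by omega) (by omega)
            have := hG.mono2 q' i
            omega
        unfold eps at this
        omega
      by_cases hr2 : r < q' + 1
      · simp [hr1, hr2]
      · simp only [hr1, hr2, if_false]
        have : 0 ≤ eps G i r (c+1) := by
          apply eps_nonneg _ _ _ (hG.mono _ _) (hG.mono _ _)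
          left
          by_cases hp : r % 2 = q % 2
          · have := hG.inter2' i (show q + 2 ≤ r by omega) (by omega)
            omega
          · have := hG.inter'' (i+2) (show q' + 2 ≤ r by omega) (by omega)
            omega
        unfold eps at this
        omega
    omega

lemma claimB (h : FV N K G i q c) (hG : IsGT 2 N inn out G) (q' : ℕ)
    (hq' : q' = q ∨ q' + 1 = q) : ¬ (G q' i ≤ c ∧ c + 1 ≤ G (q'+2) (i+2)) := by
  rintro ⟨ha, hb⟩
  have h1 := hG.inter2 q' i
  rcases hq' with rfl | rfl
  · have := h.le hG
    omega
  · have h0 := h.before i h.hi q' (by have := h.hq; omega) c (Or.inr ⟨rfl, by omega⟩)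
    have h2 : eps G i q' c = 1 := by
      have := hG.mono2 q' i
      unfold eps ff
      omega
    have h3 := h.zero hG
    rw [BB_succ _ _ _ _ _ (by have := h.hq; omega)] at h3
    omega

def tlo (G : ℕ → ℕ → ℕ) (i q' : ℕ) : ℕ := max (G q' i) (G (q'+2) (i+2))
def thi (G : ℕ → ℕ → ℕ) (i q c q' : ℕ) : ℕ :=
  min (min (G q' (i+2)) (CC q c q')) (if 2 ≤ q' then G (q'-2) i else CC q c q')

def toggle (i q c : ℕ) (G : ℕ → ℕ → ℕ) : ℕ → ℕ → ℕ := fun q' l =>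
  if l = i + 1 then
    (if CC q c q' < G q' (i+1) then G q' (i+1) else tlo G i q' + thi G i q c q' - G q' (i+1))
  else G q' l

lemma toggle_ne {l : ℕ} (hl : l ≠ i + 1) (q' : ℕ) : toggle i q c G q' l = G q' l := by
  simp [toggle, hl]

lemma toggle_bounds (hG : IsGT 2 N inn out G) (q' : ℕ) :
    tlo G i q' ≤ G q' (i+1) ∧ (G q' (i+1) ≤ CC q c q' → G q' (i+1) ≤ thi G i q c q') := by
  have h1 := hG.mono q' i
  have h2 := hG.mono2 q' i
  have h3 := hG.inter2 q' i
  refine ⟨max_le h1 h3, fun hC => ?_⟩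
  refine le_min (le_min h2 hC) ?_
  split_ifs with hq
  · have := hG.inter (q'-2) i
    rwa [show q' - 2 + 2 = q' by omega] at this
  · exact hC

lemma toggle_eqA (q' : ℕ) (hA : CC q c q' < G q' (i+1)) :
    toggle i q c G q' (i+1) = G q' (i+1) := by
  simp [toggle, hA]

lemma toggle_eqB (hG : IsGT 2 N inn out G) (q' : ℕ) (hA : G q' (i+1) ≤ CC q c q') :
    toggle i q c G q' (i+1) + G q' (i+1) = tlo G i q' + thi G i q c q' := by
  have := toggle_bounds (i := i) (c := c) (q := q) hG q'
  simp only [toggle, if_true, not_lt.2 hA, if_false]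
  omega

lemma toggle_isGT (hG : IsGT 2 N inn out G) (hi : i + 2 ≤ N) :
    IsGT 2 N inn out (toggle i q c G) := by
  have key : ∀ q', tlo G i q' ≤ toggle i q c G q' (i+1) ∧ toggle i q c G q' (i+1) ≤ G q' (i+2)
      ∧ (2 ≤ q' → toggle i q c G q' (i+1) ≤ G (q'-2) i) := by
    intro q'
    have hb := toggle_bounds (i := i) (c := c) (q := q) hG q'
    by_cases hA : CC q c q' < G q' (i+1)
    · rw [toggle_eqA _ hA]
      refine ⟨hb.1, hG.mono _ _, fun hq => ?_⟩
      have := hG.inter (q'-2) i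
      rwa [show q' - 2 + 2 = q' by omega] at this
    · have := toggle_eqB (i := i) (c := c) (q := q) hG q' (by omega)
      have h2 := hb.2 (by omega)
      have h3 : thi G i q c q' ≤ G q' (i+2) := (min_le_left _ _).trans (min_le_left _ _)
      refine ⟨by omega, by omega, fun hq => ?_⟩
      have h4 : thi G i q c q' ≤ G (q'-2) i := by
        refine (min_le_right _ _).trans ?_
        simp [hq]
      omega
  constructor
  · intro q'
    rw [toggle_ne (by omega)]
    exact hG.zero q'
  · intro q' l hl
    rw [toggle_ne (by omega)]
    exact hG.top q' l hl
  · intro q' l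
    by_cases h1 : l = i
    · subst h1
      rw [toggle_ne (by omega)]
      exact (le_max_left _ _).trans (key q').1
    by_cases h2 : l = i + 1
    · subst h2
      rw [toggle_ne (l := i+1+1) (by omega)]
      exact (key q').2.1
    rw [toggle_ne h2, toggle_ne (by omega)]
    exact hG.mono q' l
  · intro q' l
    by_cases h1 : l = i
    · subst h1
      rw [toggle_ne (l := l) (by omega)]
      have := (key (q'+2)).2.2 (by omega)
      simpa using this
    by_cases h2 : l = i + 1
    · subst h2
      rw [toggle_ne (l := i+1+1) (by omega)]
      exact (le_max_right _ _).trans (key q').1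
    rw [toggle_ne h2, toggle_ne (by omega)]
    exact hG.inter q' l

lemma toggle_type (hG : IsGT 2 N inn out G) (q' : ℕ) :
    toggle i q c G q' (i+1) ≤ CC q c q' ↔ G q' (i+1) ≤ CC q c q' := by
  by_cases hA : CC q c q' < G q' (i+1)
  · rw [toggle_eqA _ hA]
  · have hb := toggle_bounds (i := i) (c := c) (q := q) hG q'
    have := toggle_eqB (i := i) (c := c) (q := q) hG q' (by omega)
    have h2 := hb.2 (by omega)
    have h3 : thi G i q c q' ≤ CC q c q' := (min_le_left _ _).trans (min_le_right _ _)
    constructor <;> intro <;> omega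

lemma toggle_toggle (hG : IsGT 2 N inn out G) (hi : i + 2 ≤ N) :
    toggle i q c (toggle i q c G) = G := by
  funext q' l
  by_cases hl : l = i + 1
  · subst hl
    by_cases hA : CC q c q' < G q' (i+1)
    · have h1 := toggle_eqA (i := i) (c := c) (q := q) q' hA
      rw [toggle_eqA _ (by rw [h1]; exact hA), h1]
    · have hG' := toggle_isGT (q := q) (c := c) hG hi
      have h1 := toggle_eqB (i := i) (c := c) (q := q) hG q' (by omega)
      have h2 := toggle_eqB (i := i) (c := c) (q := q) hG' q' ((toggle_type hG q').2 (by omega))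
      have h3 : tlo (toggle i q c G) i q' = tlo G i q' := by
        unfold tlo
        rw [toggle_ne (by omega), toggle_ne (by omega)]
      have h4 : thi (toggle i q c G) i q c q' = thi G i q c q' := by
        unfold thi
        rw [toggle_ne (by omega), toggle_ne (by omega)]
      omega
  · rw [toggle_ne hl, toggle_ne hl]

lemma toggle_sub (hG : IsGT 2 N inn out G) (q' l C : ℕ) (hC : CC q c q' ≤ C) :
    toggle i q c G q' l - C = G q' l - C := by
  by_cases hl : l = i + 1
  · subst hl
    by_cases hA : CC q c q' < G q' (i+1)
    · rw [toggle_eqA _ hA]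
    · have := (toggle_type (i := i) (c := c) (q := q) hG q').2 (by omega)
      omega
  · rw [toggle_ne hl]

lemma toggle_BB (hG : IsGT 2 N inn out G) (j q' c' : ℕ) (h : c < c' ∨ c' = c ∧ q' ≤ q + 1) :
    BB K (toggle i q c G) j q' c' = BB K G j q' c' := by
  unfold BB
  apply Finset.sum_congr rfl
  intro r hr
  have : CC q c r ≤ (if r < q' then c' else c' + 1) := by
    unfold CC
    split_ifs <;> omega
  unfold ff
  simp only [toggle_sub hG _ _ _ this]

lemma toggle_FV (h : FV N K G i q c) (hG : IsGT 2 N inn out G) :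
    FV N K (toggle i q c G) i q c := by
  refine ⟨h.hq, h.hi, ?_, ?_⟩
  · rw [toggle_BB hG _ _ _ (by omega)]
    exact h.neg
  · intro j hj q' hq' c' hc'
    rw [toggle_BB hG _ _ _ (by omega)]
    exact h.before j hj q' hq' c' hc'

lemma sum_shift2 (K : ℕ) (P Q : ℕ → ℤ) (hPQ : ∀ q, P q = Q (q+2)) (h0 : Q 0 = 0) (h1 : Q 1 = 0)
    (hP : ∀ q, K ≤ q + 2 → P q = 0) : ∑ q ∈ range K, P q = ∑ q ∈ range K, Q q := by
  have e1 : ∑ q ∈ range (K+2), Q q = ∑ q ∈ range K, P q := by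
    rw [Finset.sum_range_succ', Finset.sum_range_succ', h0, h1]
    simp [hPQ]
  rw [Finset.sum_range_succ, Finset.sum_range_succ] at e1
  have hz : ∀ m, K ≤ m → Q m = 0 := by
    intro m hm
    match m with
    | 0 => exact h0
    | 1 => exact h1
    | m+2 => rw [← hPQ]; exact hP _ hm
  rw [hz K le_rfl, hz (K+1) (by omega)] at e1
  linarith

lemma toggle_min_sum (h : FV N K G i q c) (hG : IsGT 2 N inn out G) (hK : ∀ q, K ≤ q → out q = 0) :
    ∑ r ∈ range K, (((min (G r (i+1)) (CC q c r) : ℕ) : ℤ) + ((min (toggle i q c G r (i+1)) (CC q c r) : ℕ) : ℤ))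
    = ∑ r ∈ range K, (((min (G r i) (CC q c r) : ℕ) : ℤ) + ((min (G r (i+2)) (CC q c r) : ℕ) : ℤ)) := by
  have hrow : ∀ r ∈ range K, (((min (G r (i+1)) (CC q c r) : ℕ) : ℤ) + ((min (toggle i q c G r (i+1)) (CC q c r) : ℕ) : ℤ))
      = ((min (CC q c r) (tlo G i r) : ℕ) : ℤ) + ((thi G i q c r : ℕ) : ℤ) := by
    intro r hr
    have hr' := mem_range.1 hr
    have hb := toggle_bounds (i := i) (c := c) (q := q) hG r
    have ht := toggle_type (i := i) (c := c) (q := q) hG r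
    have h3 : thi G i q c r ≤ CC q c r := (min_le_left _ _).trans (min_le_right _ _)
    by_cases hA : CC q c r < G r (i+1)
    · have h1 := toggle_eqA (i := i) (c := c) (q := q) r hA
      have h2 := claimA h hG r hr' hA
      have h4 : CC q c r ≤ tlo G i r := by unfold tlo; omega
      have h5 : CC q c r ≤ thi G i q c r := by
        have := hG.mono2 r i
        refine le_min (le_min (by omega) le_rfl) ?_
        split_ifs with hq
        · have := hG.inter (r-2) i
          rw [show r - 2 + 2 = r by omega] at this
          omega
        · exact le_rfl
      rw [h1]
      omega
    · have := toggle_eqB (i := i) (c := c) (q := q) hG r (by omega)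
      omega
  rw [Finset.sum_congr rfl hrow]
  have := sum_shift2 K
    (fun r => ((min (CC q c r) (tlo G i r) : ℕ) : ℤ) - ((min (G r i) (CC q c r) : ℕ) : ℤ))
    (fun r => ((min (G r (i+2)) (CC q c r) : ℕ) : ℤ) - ((thi G i q c r : ℕ) : ℤ)) ?_ ?_ ?_ ?_
  · rw [Finset.sum_sub_distrib, Finset.sum_sub_distrib] at this
    rw [Finset.sum_add_distrib, Finset.sum_add_distrib]
    linarith
  · intro r
    have hB := claimB h hG r
    simp only [tlo, thi, show 2 ≤ r + 2 by omega, if_true, show r + 2 - 2 = r by omega, CC]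
    generalize G r i = a at *
    generalize G (r+2) (i+2) = b at *
    split_ifs <;> omega
  · simp [thi]
  · simp [thi]
  · intro r hr
    have : G (r+2) (i+2) = 0 := hG.row_zero (hK _ hr) _
    simp only [tlo, this]
    omega

/-- weight -/
def wt (K : ℕ) (G : ℕ → ℕ → ℕ) (l : ℕ) : ℕ := ∑ q ∈ range K, (G q (l+1) - G q l)

lemma wt_cast {p : ℕ} (hG : IsGT p N inn out G) (l : ℕ) :
    (wt K G l : ℤ) = ∑ q ∈ range K, ((G q (l+1) : ℤ) - (G q l : ℤ)) := by
  unfold wt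
  push_cast
  apply Finset.sum_congr rfl
  intro r _
  have := hG.mono r l
  omega

lemma toggle_wt_ne (l : ℕ) (h1 : l ≠ i) (h2 : l ≠ i + 1) :
    wt K (toggle i q c G) l = wt K G l := by
  unfold wt
  apply Finset.sum_congr rfl
  intro r _
  rw [toggle_ne (by omega), toggle_ne (by omega)]

lemma toggle_wt (h : FV N K G i q c) (hG : IsGT 2 N inn out G) (hK : ∀ q, K ≤ q → out q = 0) :
    wt K (toggle i q c G) i + 1 = wt K G (i+1) ∧ wt K (toggle i q c G) (i+1) = wt K G i + 1 := by
  have hG' := toggle_isGT (q := q) (c := c) hG h.hi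
  have e1 := wt_cast (K := K) hG i
  have e2 := wt_cast (K := K) hG (i+1)
  have e3 := wt_cast (K := K) hG' i
  have e4 := wt_cast (K := K) hG' (i+1)
  have hm := toggle_min_sum h hG hK
  have hB : BB K G i (q+1) c = -1 := by
    rw [BB_succ _ _ _ _ _ h.hq, h.zero hG, h.eps hG]; rfl
  have hs : (wt K (toggle i q c G) i : ℤ) + wt K (toggle i q c G) (i+1) = wt K G i + wt K G (i+1) := by
    rw [e1, e2, e3, e4, ← Finset.sum_add_distrib, ← Finset.sum_add_distrib]
    apply Finset.sum_congr rfl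
    intro r _
    rw [toggle_ne (l := i) (by omega), toggle_ne (l := i+1+1) (by omega)]
    ring
  have hd : (wt K (toggle i q c G) i : ℤ) - wt K (toggle i q c G) (i+1) + (wt K G i - wt K G (i+1))
      = 2 * BB K G i (q+1) c := by
    have : (wt K (toggle i q c G) i : ℤ) - wt K (toggle i q c G) (i+1) + (wt K G i - wt K G (i+1))
      - 2 * BB K G i (q+1) c = 2 * (∑ r ∈ range K, (((min (G r (i+1)) (CC q c r) : ℕ) : ℤ) + ((min (toggle i q c G r (i+1)) (CC q c r) : ℕ) : ℤ))
    - ∑ r ∈ range K, (((min (G r i) (CC q c r) : ℕ) : ℤ) + ((min (G r (i+2)) (CC q c r) : ℕ) : ℤ))) := by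
      rw [e1, e2, e3, e4]
      unfold BB
      simp only [← Finset.sum_add_distrib, ← Finset.sum_sub_distrib, Finset.mul_sum]
      apply Finset.sum_congr rfl
      intro r _
      have hh : (if r < q + 1 then c else c + 1) = CC q c r := rfl
      rw [hh]
      have t1 := toggle_sub (i := i) (q := q) (c := c) hG r (i+1) _ le_rfl
      rw [toggle_ne (l := i) (by omega), toggle_ne (l := i+1+1) (by omega)]
      unfold ff
      generalize CC q c r = C at *
      generalize toggle i q c G r (i+1) = y' at *
      rw [show i + 1 + 1 = i + 2 from rfl]
      have a1 : ∀ y C : ℕ, (y : ℤ) = ((min y C : ℕ) : ℤ) + ((y - C : ℕ) : ℤ) := by intros; omega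
      have b1 := a1 y' C
      have b2 := a1 (G r i) C
      have b3 := a1 (G r (i+1)) C
      have b4 := a1 (G r (i+2)) C
      rw [t1] at b1
      linarith
    rw [hm] at this
    linarith
  rw [hB] at hd
  omega

end FVlemmas

lemma Good.wt_antitone {p N K : ℕ} {inn out : ℕ → ℕ} {G : ℕ → ℕ → ℕ} (h : Good N K G) (hG : IsGT p N inn out G) :
    ∀ i, i + 2 ≤ N → wt K G (i+1) ≤ wt K G i := by
  intro i hi
  have := h i hi K le_rfl 0
  have e1 := wt_cast (K := K) hG i
  have e2 := wt_cast (K := K) hG (i+1)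
  have : BB K G i K 0 = (wt K G i : ℤ) - wt K G (i+1) := by
    rw [e1, e2, ← Finset.sum_sub_distrib]
    unfold BB
    apply Finset.sum_congr rfl
    intro r hr
    simp only [mem_range.1 hr, if_true, ff, Nat.sub_zero]
    ring
  omega

end SLC

namespace SLC
open Finset

def sh (a b : ℕ → ℕ) : ℕ → ℕ := fun q => if q % 2 = 0 then b (q/2) else a (q/2)

@[simp] lemma sh_even (a b : ℕ → ℕ) (r : ℕ) : sh a b (2*r) = b r := by
  simp [sh]

@[simp] lemma sh_odd (a b : ℕ → ℕ) (r : ℕ) : sh a b (2*r+1) = a r := by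
  have : (2*r+1)/2 = r := by omega
  simp [sh, this]

/-- order constraints between nodes (row, level) -/
def EE (u v : ℕ × ℕ) : Prop := (v.1 = u.1 ∧ v.2 = u.2 + 1) ∨ (u.1 = v.1 + 1 ∧ u.2 = v.2 + 1)

def xx (G : ℕ → ℕ → ℕ) (u : ℕ × ℕ) : ℕ := G (2*u.1+1) u.2
def yy (G : ℕ → ℕ → ℕ) (u : ℕ × ℕ) : ℕ := G (2*u.1) u.2

def Link (G : ℕ → ℕ → ℕ) (u v : ℕ × ℕ) : Prop := EE u v ∧ (yy G v < xx G u ∨ xx G v < yy G u)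

def D0 (N : ℕ) (a b : ℕ → ℕ) (u : ℕ × ℕ) : Prop := N ≤ u.2 ∧ b u.1 < a u.1

def CR (N : ℕ) (a b : ℕ → ℕ) (G : ℕ → ℕ → ℕ) (u : ℕ × ℕ) : Prop :=
  ∃ d, D0 N a b d ∧ Relation.ReflTransGen (fun u v => Link G u v ∨ Link G v u) d u

open Classical in
noncomputable def Phi (N : ℕ) (a b : ℕ → ℕ) (G : ℕ → ℕ → ℕ) : ℕ → ℕ → ℕ := fun q l =>
  if CR N a b G (q/2, l) then (if q % 2 = 0 then G (q+1) l else G (q-1) l) else G q l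

section Phi
variable {N k : ℕ} {inn a b : ℕ → ℕ} {G : ℕ → ℕ → ℕ}

lemma xx_Phi_in {u : ℕ × ℕ} (h : CR N a b G u) : xx (Phi N a b G) u = yy G u := by
  have : (2*u.1+1)/2 = u.1 := by omega
  simp [xx, yy, Phi, this, h]

lemma yy_Phi_in {u : ℕ × ℕ} (h : CR N a b G u) : yy (Phi N a b G) u = xx G u := by
  have : (2*u.1)/2 = u.1 := by omega
  simp [xx, yy, Phi, h]

lemma xx_Phi_out {u : ℕ × ℕ} (h : ¬ CR N a b G u) : xx (Phi N a b G) u = xx G u := by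
  have : (2*u.1+1)/2 = u.1 := by omega
  simp [xx, Phi, this, h]

lemma yy_Phi_out {u : ℕ × ℕ} (h : ¬ CR N a b G u) : yy (Phi N a b G) u = yy G u := by
  have : (2*u.1)/2 = u.1 := by omega
  simp [yy, Phi, h]

lemma gt_ext {G G' : ℕ → ℕ → ℕ} (hx : ∀ u, xx G u = xx G' u) (hy : ∀ u, yy G u = yy G' u) : G = G' := by
  funext q l
  rcases Nat.even_or_odd' q with ⟨r, rfl | rfl⟩
  · exact hy (r, l)
  · exact hx (r, l)

lemma xx_le (hG : IsGT 2 N inn (sh a b) G) {u v} (h : EE u v) : xx G u ≤ xx G v := by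
  obtain ⟨r, l⟩ := u
  obtain ⟨r', l'⟩ := v
  rcases h with ⟨h1, h2⟩ | ⟨h1, h2⟩
  · simp only at h1 h2
    subst h1 h2
    exact hG.mono _ _
  · simp only at h1 h2
    subst h1 h2
    exact hG.inter _ _

lemma yy_le (hG : IsGT 2 N inn (sh a b) G) {u v} (h : EE u v) : yy G u ≤ yy G v := by
  obtain ⟨r, l⟩ := u
  obtain ⟨r', l'⟩ := v
  rcases h with ⟨h1, h2⟩ | ⟨h1, h2⟩
  · simp only at h1 h2
    subst h1 h2
    exact hG.mono _ _
  · simp only at h1 h2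
    subst h1 h2
    exact hG.inter _ _

lemma CR_lt (hG : IsGT 2 N inn (sh a b) G) {u} (h : CR N a b G u) : yy G u < xx G u := by
  obtain ⟨d, hd, h⟩ := h
  induction h with
  | refl =>
    unfold xx yy
    rw [hG.top _ _ hd.1, hG.top _ _ hd.1, sh_even, sh_odd]
    exact hd.2
  | tail _ h ih =>
    rcases h with ⟨he, h⟩ | ⟨he, h⟩
    · have h1 := xx_le hG he
      have h2 := yy_le hG he
      omega
    · have h1 := xx_le hG he
      have h2 := yy_le hG he
      omega

lemma CR_link {u v} (h : CR N a b G u) (hl : Link G u v) : CR N a b G v := by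
  obtain ⟨d, hd, h⟩ := h
  exact ⟨d, hd, h.tail (Or.inl hl)⟩

lemma CR_link' {u v} (h : CR N a b G v) (hl : Link G u v) : CR N a b G u := by
  obtain ⟨d, hd, h⟩ := h
  exact ⟨d, hd, h.tail (Or.inr hl)⟩

lemma Phi_le (hG : IsGT 2 N inn (sh a b) G) {u v} (h : EE u v) :
    xx (Phi N a b G) u ≤ xx (Phi N a b G) v ∧ yy (Phi N a b G) u ≤ yy (Phi N a b G) v := by
  have h1 := xx_le hG h
  have h2 := yy_le hG h
  by_cases hu : CR N a b G u <;> by_cases hv : CR N a b G v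
  · rw [xx_Phi_in hu, yy_Phi_in hu, xx_Phi_in hv, yy_Phi_in hv]
    exact ⟨h2, h1⟩
  · have : ¬ Link G u v := fun hl => hv (CR_link hu hl)
    simp only [Link, h, true_and] at this
    rw [xx_Phi_in hu, yy_Phi_in hu, xx_Phi_out hv, yy_Phi_out hv]
    omega
  · have : ¬ Link G u v := fun hl => hu (CR_link' hv hl)
    simp only [Link, h, true_and] at this
    rw [xx_Phi_out hu, yy_Phi_out hu, xx_Phi_in hv, yy_Phi_in hv]
    omega
  · rw [xx_Phi_out hu, yy_Phi_out hu, xx_Phi_out hv, yy_Phi_out hv]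
    exact ⟨h1, h2⟩

lemma Phi_link (hG : IsGT 2 N inn (sh a b) G) (u v) :
    Link (Phi N a b G) u v ↔ Link G u v := by
  unfold Link
  refine and_congr_right fun h => ?_
  have h1 := xx_le hG h
  have h2 := yy_le hG h
  by_cases hu : CR N a b G u <;> by_cases hv : CR N a b G v
  · rw [xx_Phi_in hu, yy_Phi_in hu, xx_Phi_in hv, yy_Phi_in hv]
    omega
  · have : ¬ Link G u v := fun hl => hv (CR_link hu hl)
    simp only [Link, h, true_and] at this
    rw [xx_Phi_in hu, yy_Phi_in hu, xx_Phi_out hv, yy_Phi_out hv]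
    omega
  · have : ¬ Link G u v := fun hl => hu (CR_link' hv hl)
    simp only [Link, h, true_and] at this
    rw [xx_Phi_out hu, yy_Phi_out hu, xx_Phi_in hv, yy_Phi_in hv]
    omega
  · rw [xx_Phi_out hu, yy_Phi_out hu, xx_Phi_out hv, yy_Phi_out hv]

lemma Phi_CR (hG : IsGT 2 N inn (sh a b) G) (u) :
    CR N a b (Phi N a b G) u ↔ CR N a b G u := by
  unfold CR
  simp only [Phi_link hG]

lemma Phi_Phi (hG : IsGT 2 N inn (sh a b) G) : Phi N a b (Phi N a b G) = G := by
  apply gt_ext <;> intro u <;> by_cases h : CR N a b G u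
  · rw [xx_Phi_in ((Phi_CR hG u).2 h), yy_Phi_in h]
  · rw [xx_Phi_out (fun h' => h ((Phi_CR hG u).1 h')), xx_Phi_out h]
  · rw [yy_Phi_in ((Phi_CR hG u).2 h), xx_Phi_in h]
  · rw [yy_Phi_out (fun h' => h ((Phi_CR hG u).1 h')), yy_Phi_out h]

lemma Phi_isGT (hG : IsGT 2 N (sh (fun _ => 0) inn) (sh a b) G) :
    IsGT 2 N (sh (fun _ => 0) inn) (sh (fun r => min (a r) (b r)) (fun r => max (a r) (b r)))
      (Phi N a b G) := by
  have hx0 : ∀ r, ¬ CR N a b G (r, 0) := by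
    intro r h
    have := CR_lt hG h
    have h2 : xx G (r, 0) = 0 := by
      unfold xx
      rw [hG.zero, sh_odd]
    omega
  have htop : ∀ r l, N ≤ l → (CR N a b G (r, l) ↔ b r < a r) := by
    intro r l hl
    constructor
    · intro h
      have := CR_lt hG h
      unfold xx yy at this
      simp only [hG.top _ _ hl, sh_even, sh_odd] at this
      exact this
    · intro h
      exact ⟨(r, l), ⟨hl, h⟩, Relation.ReflTransGen.refl⟩
  constructor
  · intro q
    rcases Nat.even_or_odd' q with ⟨r, rfl | rfl⟩
    · exact (yy_Phi_out (hx0 r)).trans (hG.zero _)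
    · exact (xx_Phi_out (hx0 r)).trans (hG.zero _)
  · intro q l hl
    rcases Nat.even_or_odd' q with ⟨r, rfl | rfl⟩
    · change yy (Phi N a b G) (r, l) = _
      by_cases h : CR N a b G (r, l)
      · have := (htop r l hl).1 h
        rw [yy_Phi_in h, xx, hG.top _ _ hl, sh_even, sh_odd]
        dsimp only
        omega
      · have := mt (htop r l hl).2 h
        rw [yy_Phi_out h, yy, hG.top _ _ hl, sh_even, sh_even]
        dsimp only
        omega
    · change xx (Phi N a b G) (r, l) = _
      by_cases h : CR N a b G (r, l)
      · have := (htop r l hl).1 h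
        rw [xx_Phi_in h, yy, hG.top _ _ hl, sh_even, sh_odd]
        dsimp only
        omega
      · have := mt (htop r l hl).2 h
        rw [xx_Phi_out h, xx, hG.top _ _ hl, sh_odd, sh_odd]
        dsimp only
        omega
  · intro q l
    rcases Nat.even_or_odd' q with ⟨r, rfl | rfl⟩
    · exact (Phi_le hG (u := (r, l)) (v := (r, l+1)) (Or.inl ⟨rfl, rfl⟩)).2
    · exact (Phi_le hG (u := (r, l)) (v := (r, l+1)) (Or.inl ⟨rfl, rfl⟩)).1
  · intro q l
    rcases Nat.even_or_odd' q with ⟨r, rfl | rfl⟩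
    · exact (Phi_le hG (u := (r+1, l+1)) (v := (r, l)) (Or.inr ⟨rfl, rfl⟩)).2
    · exact (Phi_le hG (u := (r+1, l+1)) (v := (r, l)) (Or.inr ⟨rfl, rfl⟩)).1

lemma sum_pairs {M : Type*} [AddCommMonoid M] (k : ℕ) (f : ℕ → M) :
    ∑ q ∈ range (2*k), f q = ∑ r ∈ range k, (f (2*r) + f (2*r+1)) := by
  induction k with
  | zero => simp
  | succ k ih =>
    rw [show 2*(k+1) = 2*k+1+1 by ring, Finset.sum_range_succ, Finset.sum_range_succ, ih,
      Finset.sum_range_succ, add_assoc]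

/-- values at a node are the same as unordered pairs -/
lemma Phi_or (N : ℕ) (a b : ℕ → ℕ) (G : ℕ → ℕ → ℕ) (r l : ℕ) :
    (Phi N a b G (2*r) l = G (2*r) l ∧ Phi N a b G (2*r+1) l = G (2*r+1) l) ∨
    (Phi N a b G (2*r) l = G (2*r+1) l ∧ Phi N a b G (2*r+1) l = G (2*r) l) := by
  by_cases h : CR N a b G (r, l)
  · exact Or.inr ⟨yy_Phi_in h, xx_Phi_in h⟩
  · exact Or.inl ⟨yy_Phi_out h, xx_Phi_out h⟩

lemma Phi_wt (hG : IsGT 2 N (sh (fun _ => 0) inn) (sh a b) G) (l : ℕ) :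
    wt (2*k) (Phi N a b G) l = wt (2*k) G l := by
  have e1 := wt_cast (K := 2*k) hG l
  have e2 := wt_cast (K := 2*k) (Phi_isGT hG) l
  have : ((wt (2*k) (Phi N a b G) l : ℕ) : ℤ) = wt (2*k) G l := by
    rw [e1, e2, sum_pairs, sum_pairs]
    apply Finset.sum_congr rfl
    intro r _
    have h1 := Phi_or N a b G r l
    have h2 := Phi_or N a b G r (l+1)
    omega
  exact_mod_cast this

lemma Phi_ff (N : ℕ) (a b : ℕ → ℕ) (G : ℕ → ℕ → ℕ) (i r C : ℕ) :
    ff (Phi N a b G) i (2*r) C + ff (Phi N a b G) i (2*r+1) C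
      = ff G i (2*r) C + ff G i (2*r+1) C := by
  unfold ff
  rcases Phi_or N a b G r i with ⟨h1, h2⟩ | ⟨h1, h2⟩ <;>
  rcases Phi_or N a b G r (i+1) with ⟨h3, h4⟩ | ⟨h3, h4⟩ <;>
  rcases Phi_or N a b G r (i+2) with ⟨h5, h6⟩ | ⟨h5, h6⟩ <;>
  rw [h1, h2, h3, h4, h5, h6] <;> ring

lemma Phi_BB (k : ℕ) (N : ℕ) (a b : ℕ → ℕ) (G : ℕ → ℕ → ℕ) (i m c : ℕ) :
    BB (2*k) (Phi N a b G) i (2*m) c = BB (2*k) G i (2*m) c := by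
  unfold BB
  rw [sum_pairs, sum_pairs]
  apply Finset.sum_congr rfl
  intro r _
  have h1 : (2*r+1 < 2*m) ↔ (2*r < 2*m) := by omega
  simp only [h1, Phi_ff]

lemma Phi_good (hG : IsGT 2 N (sh (fun _ => 0) inn) (sh a b) G) (h : Good N (2*k) G) :
    Good N (2*k) (Phi N a b G) := by
  intro i hi q hq c
  rcases Nat.even_or_odd' q with ⟨m, rfl | rfl⟩
  · rw [Phi_BB]
    exact h i hi _ hq c
  · by_contra hneg
    push Not at hneg
    have hG' := Phi_isGT hG
    set G' := Phi N a b G with hGdef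
    have e1 : BB (2*k) G' i (2*m) c = BB (2*k) G i (2*m) c := Phi_BB ..
    have e2 : BB (2*k) G' i (2*m+1+1) c = BB (2*k) G i (2*m+1+1) c := Phi_BB (m := m+1) ..
    have p1 := h i hi (2*m) (by omega) c
    have p2 := h i hi (2*m+1+1) (by omega) c
    have p3 := h i hi (2*m+1) (by omega) c
    have s1 := BB_succ (2*k) G' i (2*m) c (by omega)
    have s2 := BB_succ (2*k) G' i (2*m+1) c (by omega)
    have s3 := BB_succ (2*k) G i (2*m) c (by omega)
    have m1 := hG'.mono (2*m) i
    have m2 := hG'.mono2 (2*m) i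
    have m3 := hG'.mono (2*m+1) i
    have m4 := hG'.mono2 (2*m+1) i
    have g1 : eps G' i (2*m) c < 0 := by omega
    have g2 : eps G' i (2*m) c = -1 := by have := eps_ge i (2*m) c m1 m2; omega
    have g3 : 0 < eps G' i (2*m+1) c := by omega
    have n1 : G' (2*m) i ≤ c := by unfold eps ff at g2; omega
    have n2 : G' (2*m) (i+1) ≤ c := by unfold eps ff at g2; omega
    have n3 : c < G' (2*m) (i+2) := by unfold eps ff at g2; omega
    have n4 : G' (2*m+1) i ≤ c := by unfold eps ff at g3; omega
    have n5 : c < G' (2*m+1) (i+1) := by unfold eps ff at g3; omega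
    have n6 : c < G' (2*m+1) (i+2) := by omega
    have hno : ¬ CR N a b G (m, i+1) := by
      intro hc
      have q1 := CR_lt hG hc
      have q2 : G' (2*m) (i+1) = xx G (m, i+1) := yy_Phi_in hc
      have q3 : G' (2*m+1) (i+1) = yy G (m, i+1) := xx_Phi_in hc
      omega
    have r1 : G' (2*m) (i+1) = G (2*m) (i+1) := yy_Phi_out hno
    have r2 := Phi_or N a b G m i
    have r3 := Phi_or N a b G m (i+2)
    rw [← hGdef] at r2 r3
    have g4 : eps G i (2*m) c = -1 := by
      have o1 := hG.mono (2*m) i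
      have o2 := hG.mono2 (2*m) i
      have v1 : G (2*m) (i+1) ≤ c := by omega
      have v2 : c < G (2*m) (i+2) := by omega
      unfold eps ff
      omega
    omega

end Phi
end SLC

namespace SLC
open Finset

section alg
variable {R : Type*} [CommRing R] (x : ℕ → R)

noncomputable def HP (n : ℕ) : PowerSeries R := ∏ i ∈ range n, PowerSeries.mk (fun m => x i ^ m)

noncomputable def HN (n : ℕ) (m : ℤ) : R := if 0 ≤ m then PowerSeries.coeff m.toNat (HP x n) else 0

lemma HN_neg (n : ℕ) {m : ℤ} (hm : m < 0) : HN x n m = 0 := by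
  simp [HN, not_le.2 hm]

lemma HN_nat (n m : ℕ) : HN x n (m : ℤ) = PowerSeries.coeff m (HP x n) := by
  simp [HN]

lemma geo_eq (y : R) : (PowerSeries.mk (fun m => y ^ m) : PowerSeries R)
    = 1 + PowerSeries.C y * (PowerSeries.X * PowerSeries.mk (fun m => y ^ m)) := by
  ext n
  cases n with
  | zero => simp
  | succ n => simp [PowerSeries.coeff_succ_X_mul, PowerSeries.coeff_one, pow_succ']

lemma HP_succ (n : ℕ) : HP x (n+1) = HP x n + PowerSeries.C (x n) * (PowerSeries.X * HP x (n+1)) := by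
  unfold HP
  rw [Finset.prod_range_succ]
  conv_lhs => rw [geo_eq]
  ring

lemma HN_succ (n : ℕ) (m : ℤ) : HN x (n+1) m = HN x n m + x n * HN x (n+1) (m-1) := by
  rcases lt_or_ge m 0 with h | h
  · rw [HN_neg x _ h, HN_neg x _ h, HN_neg x _ (by omega)]
    simp
  · obtain ⟨m, rfl⟩ := Int.eq_ofNat_of_zero_le h
    rw [HN_nat, HN_nat]
    conv_lhs => rw [HP_succ]
    cases m with
    | zero => rw [HN_neg x _ (by simp)]; simp
    | succ m =>
      rw [show ((m+1 : ℕ) : ℤ) - 1 = (m : ℤ) by push_cast; ring, HN_nat]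
      simp [PowerSeries.coeff_succ_X_mul]

lemma HN_expand (n d : ℕ) (m : ℤ) : HN x (n+1) m =
    ∑ a ∈ range (d+1), x n ^ a * HN x n (m - a) + x n ^ (d+1) * HN x (n+1) (m - d - 1) := by
  induction d with
  | zero =>
    rw [HN_succ]
    simp
  | succ d ih =>
    rw [Finset.sum_range_succ, ih, HN_succ x n (m - d - 1)]
    push_cast
    rw [show m - (d + 1 : ℤ) = m - d - 1 by ring]
    ring

lemma HN_zero (m : ℤ) : HN x 0 m = if m = 0 then 1 else 0 := by
  unfold HN HP
  by_cases h : m = 0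
  · simp [h]
  · by_cases h2 : 0 ≤ m
    · have : m.toNat ≠ 0 := by omega
      simp [h, h2, PowerSeries.coeff_one]
      omega
    · simp [h, h2]

noncomputable def JT (n k : ℕ) (lam : ℕ → ℕ) : R :=
  Matrix.det (Matrix.of fun i j : Fin k => HN x n ((lam i : ℤ) - (i : ℤ) + (j : ℤ)))

lemma det_row_op (k : ℕ) (A B : Matrix (Fin k) (Fin k) R) (c : Fin k → R)
    (h : ∀ i j, A i j = B i j + c i * (if h : (i : ℕ) + 1 < k then A ⟨i + 1, h⟩ j else 0)) :
    A.det = B.det := by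
  cases k with
  | zero => simp
  | succ k =>
    rw [← Matrix.det_submatrix_equiv_self Fin.revPerm A, ← Matrix.det_submatrix_equiv_self Fin.revPerm B]
    apply Matrix.det_eq_of_forall_row_eq_smul_add_pred (fun i => c (Fin.rev i.succ))
    · intro j
      simp only [Matrix.submatrix_apply, Fin.revPerm_apply]
      rw [h]
      simp
    · intro i j
      simp only [Matrix.submatrix_apply, Fin.revPerm_apply]
      rw [h]
      have hi := i.2
      have h1 : ((Fin.rev i.succ : Fin (k+1)) : ℕ) + 1 < k + 1 := by
        simp [Fin.val_rev]; omega
      rw [dif_pos h1]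
      have h2 : (⟨((Fin.rev i.succ : Fin (k+1)) : ℕ) + 1, h1⟩ : Fin (k+1)) = Fin.rev i.castSucc := by
        ext
        simp [Fin.val_rev]; omega
      rw [h2]

def ext0 (k : ℕ) (f : Fin k → ℕ) : ℕ → ℕ := fun q => if h : q < k then f ⟨q, h⟩ else 0

lemma JT_succ (n k : ℕ) (lam : ℕ → ℕ) (hl : Antitone lam) (h0 : ∀ j, k ≤ j → lam j = 0) :
    JT x (n+1) k lam = ∑ f ∈ Fintype.piFinset (fun i : Fin k => Icc (lam (i+1)) (lam i)),
      x n ^ (∑ i : Fin k, (lam i - f i)) * JT x n k (ext0 k f) := by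
  unfold JT
  rw [det_row_op k _ (Matrix.of fun i j : Fin k =>
      ∑ y ∈ Icc (lam (i+1)) (lam i), x n ^ (lam i - y) * HN x n ((y : ℤ) - i + j))
      (fun i => x n ^ (lam i - lam (i+1) + 1))]
  · have := (Matrix.detRowAlternating (R := R) (n := Fin k)).toMultilinearMap.map_sum_finset
      (fun (i : Fin k) (y : ℕ) => fun j : Fin k => x n ^ (lam i - y) * HN x n ((y : ℤ) - i + j))
      (fun i => Icc (lam (i+1)) (lam i))
    convert this using 2
    · congr 1
      ext i j
      simp
    · rename_i f hf
      rw [← Finset.prod_pow_eq_pow_sum]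
      rw [← Matrix.det_mul_column]
      change _ = Matrix.det _
      congr 1
      ext i j
      simp [ext0]
  · intro i j
    simp only [Matrix.of_apply]
    rw [HN_expand x n (lam i - lam (i+1))]
    have hle : lam (i+1) ≤ lam i := hl (by omega)
    congr 1
    · symm
      apply Finset.sum_bij' (fun y _ => lam i - y) (fun a _ => lam i - a)
      · intro y hy; simp at hy ⊢; omega
      · intro y hy; simp at hy ⊢; omega
      · intro y hy; simp at hy ⊢; omega
      · intro y hy; simp at hy ⊢; omega
      · intro y hy
        simp at hy
        congr 2
        omega
    · congr 1
      split_ifs with h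
      · congr 1
        push_cast [hle]
        ring
      · apply HN_neg
        have : lam (i+1) = 0 := h0 _ (by omega)
        have := j.2
        have := i.2
        omega

open Classical in
noncomputable def GTs (p N : ℕ) (inn out : ℕ → ℕ) : Finset (ℕ → ℕ → ℕ) :=
  if h : {G | IsGT p N inn out G}.Finite then h.toFinset else ∅

lemma mem_GTs {p N : ℕ} {inn out : ℕ → ℕ} {K : ℕ} (hK : ∀ q, K ≤ q → out q = 0) {G : ℕ → ℕ → ℕ} :
    G ∈ GTs p N inn out ↔ IsGT p N inn out G := by
  unfold GTs
  rw [dif_pos (isGT_finite p N inn out K hK)]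
  simp

lemma ext0_of_ge {k q : ℕ} (f : Fin k → ℕ) (h : k ≤ q) : ext0 k f q = 0 := by
  simp [ext0, not_lt.2 h]

lemma ext0_of_lt {k q : ℕ} (f : Fin k → ℕ) (h : q < k) : ext0 k f q = f ⟨q, h⟩ := by
  simp [ext0, h]

open Classical in
lemma JT_zero (k : ℕ) (lam : ℕ → ℕ) (hl : Antitone lam) (h0 : ∀ j, k ≤ j → lam j = 0) :
    JT x 0 k lam = if lam = 0 then 1 else 0 := by
  split_ifs with h
  · subst h
    unfold JT
    rw [show (Matrix.of fun i j : Fin k => HN x 0 (((0 : ℕ → ℕ) i : ℤ) - (i : ℤ) + (j : ℤ))) = 1 from ?_,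
      Matrix.det_one]
    ext i j
    simp only [Matrix.of_apply, HN_zero, Matrix.one_apply]
    congr 1
    simp only [Pi.zero_apply, Nat.cast_zero, eq_iff_iff, Fin.ext_iff]
    omega
  · have hpos : 0 < lam 0 := by
      by_contra h1
      apply h
      funext q
      have := hl (Nat.zero_le q)
      simp; omega
    have hk : 0 < k := by
      by_contra hk
      have := h0 0 (by omega)
      omega
    apply Matrix.det_eq_zero_of_row_eq_zero ⟨0, hk⟩
    intro j
    simp only [Matrix.of_apply, HN_zero]
    rw [if_neg]
    simp
    omega

theorem JT_eq_sum (n k : ℕ) (lam : ℕ → ℕ) (hl : Antitone lam) (h0 : ∀ j, k ≤ j → lam j = 0) :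
    JT x n k lam = ∑ G ∈ GTs 1 n (fun _ => 0) lam, ∏ l ∈ range n, x l ^ wt k G l := by
  induction n generalizing lam with
  | zero =>
    rw [JT_zero x k lam hl h0]
    split_ifs with h
    · subst h
      have : GTs 1 0 (fun _ => 0) 0 = {fun _ _ => 0} := by
        ext G
        rw [mem_GTs (K := k) h0, mem_singleton]
        constructor
        · intro h
          funext q l
          exact h.top q l (Nat.zero_le _)
        · rintro rfl
          constructor <;> simp
      rw [this]
      simp
    · symm
      apply Finset.sum_eq_zero
      intro G hG
      exfalso
      rw [mem_GTs (K := k) h0] at hG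
      apply h
      funext q
      have h1 := hG.top q 0 le_rfl
      have h2 := hG.zero q
      simp; omega
  | succ n ih =>
    rw [JT_succ x n k lam hl h0]
    have key : ∀ f ∈ Fintype.piFinset (fun i : Fin k => Icc (lam (i+1)) (lam i)),
        (∀ q, lam (q+1) ≤ ext0 k f q) ∧ (∀ q, ext0 k f q ≤ lam q) := by
      intro f hf
      rw [Fintype.mem_piFinset] at hf
      constructor <;> intro q <;> by_cases hq : q < k
      · rw [ext0_of_lt f hq]
        exact (Finset.mem_Icc.1 (hf ⟨q, hq⟩)).1
      · rw [h0 _ (by omega)]; omega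
      · rw [ext0_of_lt f hq]
        exact (Finset.mem_Icc.1 (hf ⟨q, hq⟩)).2
      · rw [ext0_of_ge f (by omega)]; omega
    have anti : ∀ f ∈ Fintype.piFinset (fun i : Fin k => Icc (lam (i+1)) (lam i)),
        Antitone (ext0 k f) := by
      intro f hf
      apply antitone_nat_of_succ_le
      intro q
      exact ((key f hf).2 (q+1)).trans ((key f hf).1 q)
    rw [Finset.sum_congr rfl (fun f hf => by
      rw [ih (ext0 k f) (anti f hf) (fun j hj => ext0_of_ge f hj), Finset.mul_sum])]
    rw [Finset.sum_sigma']
    refine Finset.sum_bij'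
      (fun (s : (_ : Fin k → ℕ) × (ℕ → ℕ → ℕ)) _ => fun q l => if l ≤ n then s.2 q l else lam q)
      (fun G _ => (⟨fun i : Fin k => G i n, fun q l => G q (min l n)⟩ : (_ : Fin k → ℕ) × (ℕ → ℕ → ℕ)))
      ?_ ?_ ?_ ?_ ?_
    · rintro ⟨f, G⟩ hs
      rw [Finset.mem_sigma] at hs
      obtain ⟨hf, hG⟩ := hs
      simp only at hf hG
      rw [mem_GTs (K := k) (fun j hj => ext0_of_ge f hj)] at hG
      rw [mem_GTs (K := k) h0]
      have k1 := (key f hf).1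
      have k2 := (key f hf).2
      constructor
      · intro q
        simp only [Nat.zero_le, if_true]
        exact hG.zero q
      · intro q l hl
        simp only [show ¬ l ≤ n by omega, if_false]
      · intro q l
        have t := hG.top q l
        have m := hG.mono q l
        have := k2 q
        dsimp only
        split_ifs <;> first | omega | (have := t (by omega); omega)
      · intro q l
        have t := hG.top q l
        have m := hG.inter q l
        have := k1 q
        have := hl (Nat.le_succ q)
        dsimp only
        split_ifs <;> first | omega | (have := t (by omega); omega)
    · intro G hG
      rw [mem_GTs (K := k) h0] at hG
      have hext : ∀ q, ext0 k (fun i : Fin k => G i n) q = G q n := by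
        intro q
        by_cases hq : q < k
        · rw [ext0_of_lt _ hq]
        · rw [ext0_of_ge _ (by omega), hG.row_zero (h0 q (by omega))]
      rw [Finset.mem_sigma]
      constructor
      · rw [Fintype.mem_piFinset]
        intro i
        rw [Finset.mem_Icc]
        dsimp only
        constructor
        · rw [← hG.top _ (n+1) le_rfl]
          exact hG.inter _ _
        · rw [← hG.top _ (n+1) le_rfl]
          exact hG.mono _ _
      · rw [mem_GTs (K := k) (fun j hj => ext0_of_ge _ hj)]
        constructor
        · intro q
          simp only [Nat.zero_min]
          exact hG.zero q
        · intro q l hl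
          dsimp only
          rw [hext, min_eq_right hl]
        · intro q l
          exact hG.mono' q (by omega)
        · intro q l
          by_cases hl : l + 1 ≤ n
          · dsimp only
            rw [min_eq_left hl, min_eq_left (by omega)]
            exact hG.inter _ _
          · dsimp only
            rw [min_eq_right (by omega), min_eq_right (by omega)]
            exact (hG.mono _ _).trans (hG.inter _ _)
    · rintro ⟨f, G⟩ hs
      rw [Finset.mem_sigma] at hs
      obtain ⟨hf, hG⟩ := hs
      simp only at hf hG
      rw [mem_GTs (K := k) (fun j hj => ext0_of_ge f hj)] at hG
      refine Sigma.ext ?_ (heq_of_eq ?_)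
      · funext i
        simp only [le_refl, if_true]
        rw [hG.top _ _ le_rfl, ext0_of_lt f i.2]
      · funext q l
        simp only [min_le_right, if_true]
        by_cases hl : l ≤ n
        · rw [min_eq_left hl]
        · rw [min_eq_right (by omega), hG.top _ _ le_rfl, hG.top _ _ (by omega)]
    · intro G hG
      rw [mem_GTs (K := k) h0] at hG
      funext q l
      dsimp only
      split_ifs with h
      · rw [min_eq_left h]
      · rw [hG.top _ _ (by omega)]
    · rintro ⟨f, G⟩ hs
      rw [Finset.mem_sigma] at hs
      obtain ⟨hf, hG⟩ := hs
      simp only at hf hG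
      rw [mem_GTs (K := k) (fun j hj => ext0_of_ge f hj)] at hG
      dsimp only
      rw [Finset.prod_range_succ, mul_comm]
      congr 1
      · apply Finset.prod_congr rfl
        intro l hl
        have hl := mem_range.1 hl
        congr 1
        unfold wt
        apply Finset.sum_congr rfl
        intro q _
        simp only [show l ≤ n by omega, show l + 1 ≤ n by omega, if_true]
      · congr 1
        unfold wt
        rw [Finset.sum_range]
        apply Finset.sum_congr rfl
        intro i _
        simp only [show ¬ n + 1 ≤ n by omega, le_refl, if_true, if_false]
        rw [hG.top _ _ le_rfl, ext0_of_lt f i.2]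

def ind (k r : ℕ) : ℕ := if r < k then 1 else 0

theorem JT_mul_eq_sum (n k : ℕ) (lam mu : ℕ → ℕ) (hl : Antitone lam) (h0 : ∀ j, k ≤ j → lam j = 0)
    (hm : Antitone mu) (hm0 : ∀ j, k ≤ j → mu j = 0) :
    JT x n k lam * JT x n k mu = ∑ G ∈ GTs 2 n (sh (fun _ => 0) (ind k)) (sh lam (fun r => mu r + ind k r)),
      ∏ l ∈ range n, x l ^ wt (2*k) G l := by
  have hK : ∀ q, 2*k ≤ q → sh lam (fun r => mu r + ind k r) q = 0 := by
    intro q hq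
    have : k ≤ q / 2 := by omega
    unfold sh ind
    simp [h0 _ this, hm0 _ this]
    intros; omega
  rw [JT_eq_sum x n k lam hl h0, JT_eq_sum x n k mu hm hm0, Finset.sum_mul_sum, ← Finset.sum_product']
  refine Finset.sum_bij'
    (fun (s : (ℕ → ℕ → ℕ) × (ℕ → ℕ → ℕ)) _ => fun q l => sh (fun r => s.1 r l) (fun r => s.2 r l + ind k r) q)
    (fun G _ => (fun r l => G (2*r+1) l, fun r l => G (2*r) l - ind k r)) ?_ ?_ ?_ ?_ ?_
  · rintro ⟨A, B⟩ hs
    rw [Finset.mem_product] at hs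
    obtain ⟨hA, hB⟩ := hs
    simp only at hA hB
    rw [mem_GTs (K := k) h0] at hA
    rw [mem_GTs (K := k) hm0] at hB
    rw [mem_GTs (K := 2*k) hK]
    constructor
    · intro q
      rcases Nat.even_or_odd' q with ⟨r, rfl | rfl⟩
      · simp only [sh_even, hB.zero, zero_add]
      · simp only [sh_odd, hA.zero]
    · intro q l hl
      rcases Nat.even_or_odd' q with ⟨r, rfl | rfl⟩
      · simp only [sh_even, hB.top _ _ hl]
      · simp only [sh_odd, hA.top _ _ hl]
    · intro q l
      rcases Nat.even_or_odd' q with ⟨r, rfl | rfl⟩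
      · simp only [sh_even]
        have := hB.mono r l
        omega
      · simp only [sh_odd]
        exact hA.mono r l
    · intro q l
      rcases Nat.even_or_odd' q with ⟨r, rfl | rfl⟩
      · rw [show 2*r+2 = 2*(r+1) by ring]
        simp only [sh_even]
        have := hB.inter r l
        have : ind k (r+1) ≤ ind k r := by unfold ind; split_ifs <;> omega
        omega
      · rw [show 2*r+1+2 = 2*(r+1)+1 by ring]
        simp only [sh_odd]
        exact hA.inter r l
  · intro G hG
    rw [mem_GTs (K := 2*k) hK] at hG
    rw [Finset.mem_product, mem_GTs (K := k) h0, mem_GTs (K := k) hm0]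
    constructor
    · constructor
      · intro r
        simp only [hG.zero, sh_odd]
      · intro r l hl
        simp only [hG.top _ _ hl, sh_odd]
      · intro r l
        exact hG.mono _ _
      · intro r l
        exact hG.inter _ _
    · constructor
      · intro r
        simp only [hG.zero, sh_even, Nat.sub_self]
      · intro r l hl
        simp only [hG.top _ _ hl, sh_even, Nat.add_sub_cancel]
      · intro r l
        have := hG.mono (2*r) l
        dsimp only
        omega
      · intro r l
        have h1 : G (2*(r+1)) (l+1) ≤ G (2*r) l := hG.inter (2*r) l
        dsimp only
        by_cases hr : r + 1 < k
        · have : ind k (r+1) = ind k r := by simp [ind, hr, show r < k by omega]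
          omega
        · have : G (2*(r+1)) (l+1) = 0 := hG.row_zero (hK _ (by omega)) _
          omega
  · rintro ⟨A, B⟩ hs
    simp
  · intro G hG
    rw [mem_GTs (K := 2*k) hK] at hG
    funext q l
    rcases Nat.even_or_odd' q with ⟨r, rfl | rfl⟩
    · simp only [sh_even]
      have h1 := hG.mono' (2*r) (Nat.zero_le l)
      rw [hG.zero, sh_even] at h1
      omega
    · simp only [sh_odd]
  · rintro ⟨A, B⟩ hs
    dsimp only
    rw [← Finset.prod_mul_distrib]
    apply Finset.prod_congr rfl
    intro l _
    rw [← pow_add]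
    congr 1
    unfold wt
    rw [sum_pairs, ← Finset.sum_add_distrib]
    apply Finset.sum_congr rfl
    intro r _
    simp only [sh_even, sh_odd]
    omega

end alg
end SLC

namespace SLC
open Finset MvPolynomial

noncomputable def xv (N : ℕ) (l : ℕ) : MvPolynomial (Fin N) ℤ := if h : l < N then X ⟨l, h⟩ else 0

@[simp] lemma xv_fin (N : ℕ) (l : Fin N) : xv N l = X l := by
  simp [xv]

lemma hsymm_eq (N m : ℕ) : hsymm (Fin N) ℤ m = PowerSeries.coeff m (HP (xv N) N) := by
  classical
  unfold HP
  rw [Finset.prod_range, PowerSeries.coeff_prod]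
  simp only [PowerSeries.coeff_mk, xv_fin]
  rw [hsymm]
  refine Finset.sum_bij' (fun s _ => Multiset.toFinsupp s.1)
    (fun f hf => (⟨Finsupp.toMultiset f, by
      rw [Finset.mem_finsuppAntidiag] at hf
      rw [Finsupp.card_toMultiset, ← hf.1, Finsupp.sum_fintype]
      · rfl
      · intro; rfl⟩ : Sym (Fin N) m)) ?_ ?_ ?_ ?_ ?_
  · intro s _
    rw [Finset.mem_finsuppAntidiag]
    refine ⟨?_, Finset.subset_univ _⟩
    have h2 : Multiset.card (s : Multiset (Fin N)) = m := s.2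
    have h3 := Multiset.sum_count_eq_card (s := Finset.univ) (m := (s : Multiset (Fin N))) (by simp)
    rw [h2] at h3
    exact h3
  · intros; exact Finset.mem_univ _
  · intro s _
    apply Subtype.ext
    simp
  · intro f _
    simp
  · intro s _
    rw [Finset.prod_multiset_map_count]
    simp only [Multiset.toFinsupp_apply]
    apply Finset.prod_subset (Finset.subset_univ _)
    intro i _ hi
    rw [Multiset.count_eq_zero_of_notMem (by simpa using hi), pow_zero]

lemma homog_eq (N : ℕ) (m : ℤ) : homog N m = HN (xv N) N m := by
  unfold homog HN
  split_ifs
  · exact hsymm_eq N _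
  · rfl

lemma skewSchur_eq (N k : ℕ) (lam : ℕ → ℕ) :
    skewSchur N k lam (fun _ => 0) = JT (xv N) N k lam := by
  unfold skewSchur JT
  congr 1
  ext1 i j
  simp [homog_eq]

lemma rename_homog (N : ℕ) (m : ℤ) (σ : Equiv.Perm (Fin N)) : rename σ (homog N m) = homog N m := by
  unfold homog
  split_ifs
  · rw [rename_hsymm]
  · simp

lemma rename_JT (N k : ℕ) (lam : ℕ → ℕ) (σ : Equiv.Perm (Fin N)) :
    rename σ (JT (xv N) N k lam) = JT (xv N) N k lam := by
  unfold JT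
  rw [AlgHom.map_det]
  congr 1
  ext1 i j
  simp only [AlgHom.mapMatrix_apply, Matrix.map_apply, Matrix.of_apply, ← homog_eq, rename_homog]

noncomputable def alt (N : ℕ) (α : ℕ → ℕ) : MvPolynomial (Fin N) ℤ :=
  Matrix.det (Matrix.of fun i j : Fin N => (X i : MvPolynomial (Fin N) ℤ) ^ α j)

def rho (N : ℕ) (i : ℕ) : ℕ := N - 1 - i

lemma alt_rho_ne (N : ℕ) : alt N (rho N) ≠ 0 := by
  have h : alt N (rho N) = ((Matrix.vandermonde (fun i : Fin N => (X i : MvPolynomial (Fin N) ℤ))).submatrix id Fin.revPerm).det := by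
    unfold alt
    congr 1
    ext1 i j
    simp only [Matrix.of_apply, Matrix.submatrix_apply, Matrix.vandermonde_apply, id, Fin.revPerm_apply,
      Fin.val_rev, rho]
    congr 1
    omega
  rw [h, Matrix.det_permute']
  apply mul_ne_zero
  · rcases Int.units_eq_one_or (Equiv.Perm.sign (Fin.revPerm : Equiv.Perm (Fin N))) with h | h <;> simp [h]
  · rw [Matrix.det_vandermonde_ne_zero_iff]
    exact X_injective

lemma alt_mul_symm (N : ℕ) {ι : Type*} (s : Finset ι) (w : ι → ℕ → ℕ) (f : MvPolynomial (Fin N) ℤ)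
    (hf : f = ∑ G ∈ s, ∏ l ∈ range N, xv N l ^ w G l)
    (hsym : ∀ σ : Equiv.Perm (Fin N), rename σ f = f) :
    alt N (rho N) * f = ∑ G ∈ s, alt N (fun l => w G l + rho N l) := by
  have h1 : ∀ σ : Equiv.Perm (Fin N), f = ∑ G ∈ s, ∏ l : Fin N, (X (σ l) : MvPolynomial (Fin N) ℤ) ^ w G l := by
    intro σ
    rw [← hsym σ, hf, map_sum]
    apply Finset.sum_congr rfl
    intro G _
    rw [Finset.prod_range]
    simp
  unfold alt
  simp only [Matrix.det_apply, Matrix.of_apply]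
  rw [Finset.sum_mul, Finset.sum_comm]
  apply Finset.sum_congr rfl
  intro σ _
  conv_lhs => rw [h1 σ]
  rw [Finset.mul_sum]
  apply Finset.sum_congr rfl
  intro G _
  rw [smul_mul_assoc, ← Finset.prod_mul_distrib]
  congr 1
  apply Finset.prod_congr rfl
  intro l _
  rw [← pow_add, add_comm]

section bialt
variable {R : Type*} [CommRing R] (x : ℕ → R)

noncomputable def El (N l : ℕ) : Polynomial R :=
  ∏ i ∈ (range N).erase l, (1 - Polynomial.C (x i) * Polynomial.X)

lemma El_natDegree (N l : ℕ) (hl : l < N) : (El x N l).natDegree ≤ N - 1 := by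
  unfold El
  refine (Polynomial.natDegree_prod_le _ _).trans ?_
  have : ∀ i ∈ (range N).erase l, (1 - Polynomial.C (x i) * Polynomial.X).natDegree ≤ 1 := by
    intro i _
    compute_degree
  refine (Finset.sum_le_card_nsmul _ _ 1 this).trans ?_
  rw [Finset.card_erase_of_mem (mem_range.2 hl)]
  simp

lemma El_mul (N l : ℕ) (hl : l < N) :
    ((El x N l : Polynomial R) : PowerSeries R) * HP x N = PowerSeries.mk (fun m => x l ^ m) := by
  unfold HP
  rw [← Finset.mul_prod_erase _ _ (mem_range.2 hl)]
  have : ((El x N l : Polynomial R) : PowerSeries R) = ∏ i ∈ (range N).erase l, (1 - PowerSeries.C (x i) * PowerSeries.X) := by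
    unfold El
    have := map_prod (Polynomial.coeToPowerSeries.ringHom (R := R)) (fun i => 1 - Polynomial.C (x i) * Polynomial.X) ((range N).erase l)
    simp only [Polynomial.coeToPowerSeries.ringHom_apply] at this
    rw [this]
    apply Finset.prod_congr rfl
    intro i _
    simp
  rw [this, mul_left_comm, ← Finset.prod_mul_distrib, Finset.prod_eq_one, mul_one]
  intro i _
  have := geo_eq (x i)
  linear_combination this

lemma pow_eq_sum (N l m : ℕ) (hl : l < N) :
    x l ^ m = ∑ a ∈ range N, HN x N ((m : ℤ) - a) * (El x N l).coeff a := by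
  have h := congrArg (PowerSeries.coeff m) (El_mul x N l hl)
  rw [PowerSeries.coeff_mk, PowerSeries.coeff_mul, Finset.Nat.sum_antidiagonal_eq_sum_range_succ_mk] at h
  rw [← h]
  have e1 : ∑ a ∈ range m.succ, (PowerSeries.coeff a) ((El x N l : Polynomial R) : PowerSeries R) * (PowerSeries.coeff (m - a)) (HP x N)
      = ∑ a ∈ range m.succ, HN x N ((m : ℤ) - a) * (El x N l).coeff a := by
    apply Finset.sum_congr rfl
    intro a ha
    have := mem_range.1 ha
    rw [show (m : ℤ) - a = ((m - a : ℕ) : ℤ) by omega, HN_nat, Polynomial.coeff_coe, mul_comm]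
  rw [e1]
  have e2 : ∑ a ∈ range m.succ, HN x N ((m : ℤ) - a) * (El x N l).coeff a
      = ∑ a ∈ range (max m.succ N), HN x N ((m : ℤ) - a) * (El x N l).coeff a := by
    apply Finset.sum_subset
    · intro a ha; simp at ha ⊢; omega
    · intro a _ ha
      rw [HN_neg, zero_mul]
      simp at ha; omega
  have e3 : ∑ a ∈ range N, HN x N ((m : ℤ) - a) * (El x N l).coeff a
      = ∑ a ∈ range (max m.succ N), HN x N ((m : ℤ) - a) * (El x N l).coeff a := by
    apply Finset.sum_subset
    · intro a ha; simp at ha ⊢; omega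
    · intro a _ ha
      rw [Polynomial.coeff_eq_zero_of_natDegree_lt, mul_zero]
      have := El_natDegree x N l hl
      simp at ha; omega
  rw [e2, e3]

end bialt

lemma JT_zero_shape (N : ℕ) : JT (xv N) N N (fun _ => 0) = 1 := by
  unfold JT
  rw [Matrix.det_of_isUpperTriangular]
  · apply Finset.prod_eq_one
    intro i _
    simp only [Matrix.of_apply]
    rw [show ((0 : ℕ) : ℤ) - (i : ℕ) + (i : ℕ) = ((0 : ℕ) : ℤ) by simp, HN_nat]
    unfold HP
    simp [map_prod]
  · intro i j hij
    simp only [id] at hij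
    simp only [Matrix.of_apply]
    apply HN_neg
    have : (j : ℕ) < i := hij
    omega

lemma alt_eq_mul (N : ℕ) (nu : ℕ → ℕ) : alt N (fun l => nu l + rho N l) = JT (xv N) N N nu *
    Matrix.det (Matrix.of fun b l : Fin N => (El (xv N) N l).coeff (N - 1 - b)) := by
  unfold JT alt
  rw [← Matrix.det_mul, ← Matrix.det_transpose]
  congr 1
  ext1 j l
  rw [Matrix.mul_apply]
  simp only [Matrix.transpose_apply, Matrix.of_apply]
  rw [← xv_fin, pow_eq_sum (xv N) N l _ l.2, ← Finset.sum_range_reflect, Finset.sum_range]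
  apply Finset.sum_congr rfl
  intro b _
  congr 2
  unfold rho
  have := b.2
  have := j.2
  omega

lemma bialternant (N : ℕ) (nu : ℕ → ℕ) :
    alt N (fun l => nu l + rho N l) = alt N (rho N) * JT (xv N) N N nu := by
  have h := alt_eq_mul N (fun _ => 0)
  rw [JT_zero_shape, one_mul] at h
  rw [alt_eq_mul, ← h]
  simp only [zero_add]
  rw [mul_comm]

lemma alt_swap (N i : ℕ) (hi : i + 2 ≤ N) (α β : ℕ → ℕ) (h1 : β i = α (i+1)) (h2 : β (i+1) = α i)
    (h3 : ∀ l, l ≠ i → l ≠ i + 1 → β l = α l) : alt N α + alt N β = 0 := by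
  have : alt N β = ((Matrix.of fun a j : Fin N => (X a : MvPolynomial (Fin N) ℤ) ^ α j).submatrix id
      (Equiv.swap (⟨i, by omega⟩ : Fin N) ⟨i+1, by omega⟩)).det := by
    unfold alt
    congr 1
    ext1 a j
    simp only [Matrix.of_apply, Matrix.submatrix_apply, id]
    congr 1
    by_cases e1 : j = ⟨i, by omega⟩
    · subst e1; simp [h1]
    by_cases e2 : j = ⟨i+1, by omega⟩
    · subst e2; simp [h2]
    rw [Equiv.swap_apply_of_ne_of_ne e1 e2]
    apply h3
    · intro h; exact e1 (Fin.ext h)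
    · intro h; exact e2 (Fin.ext h)
  rw [this, Matrix.det_permute', Equiv.Perm.sign_swap]
  · simp [alt]
  · simp [Fin.ext_iff]

open Classical in
/-- sign reversing involution -/
lemma sum_good (N K : ℕ) (inn out : ℕ → ℕ) (hK : ∀ q, K ≤ q → out q = 0) :
    ∑ G ∈ GTs 2 N inn out, alt N (fun l => wt K G l + rho N l)
      = ∑ G ∈ (GTs 2 N inn out).filter (fun G => Good N K G), alt N (fun l => wt K G l + rho N l) := by
  rw [← Finset.sum_filter_add_sum_filter_not _ (fun G => Good N K G), add_eq_left]
  have hmem : ∀ G, G ∈ (GTs 2 N inn out).filter (fun G => ¬ Good N K G) ↔ IsGT 2 N inn out G ∧ ¬ Good N K G := by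
    intro G
    rw [Finset.mem_filter, mem_GTs (K := K) hK]
  have hex : ∀ G ∈ (GTs 2 N inn out).filter (fun G => ¬ Good N K G), ∃ s : ℕ × ℕ × ℕ, FV N K G s.1 s.2.1 s.2.2 := by
    intro G hG
    obtain ⟨hG, hb⟩ := (hmem G).1 hG
    have hL : ∀ q l, G q l ≤ ∑ q ∈ range K, out q := by
      intro q l
      by_cases hq : q < K
      · exact (hG.le_out q l).trans (Finset.single_le_sum (f := out) (fun _ _ => Nat.zero_le _) (mem_range.2 hq))
      · rw [hG.row_zero (hK q (by omega))]; exact Nat.zero_le _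
    obtain ⟨i, q, c, h⟩ := exists_FV _ hL hb
    exact ⟨(i, q, c), h⟩
  choose! s hs using hex
  have hnew : ∀ G (hG : G ∈ (GTs 2 N inn out).filter (fun G => ¬ Good N K G)),
      FV N K (toggle (s G).1 (s G).2.1 (s G).2.2 G) (s G).1 (s G).2.1 (s G).2.2 := by
    intro G hG
    exact toggle_FV (hs G hG) ((hmem G).1 hG).1
  have hmem' : ∀ G (hG : G ∈ (GTs 2 N inn out).filter (fun G => ¬ Good N K G)),
      toggle (s G).1 (s G).2.1 (s G).2.2 G ∈ (GTs 2 N inn out).filter (fun G => ¬ Good N K G) := by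
    intro G hG
    rw [hmem]
    refine ⟨toggle_isGT ((hmem G).1 hG).1 (hs G hG).hi, ?_⟩
    intro hgood
    have h := hnew G hG
    exact absurd h.neg (not_lt.2 (hgood _ h.hi _ h.hq (s G).2.2))
  have hzero : ∀ G (hG : G ∈ (GTs 2 N inn out).filter (fun G => ¬ Good N K G)),
      alt N (fun l => wt K G l + rho N l) +
        alt N (fun l => wt K (toggle (s G).1 (s G).2.1 (s G).2.2 G) l + rho N l) = 0 := by
    intro G hG
    have h := hs G hG
    have hG' := ((hmem G).1 hG).1
    have hi := h.hi
    obtain ⟨w1, w2⟩ := toggle_wt h hG' hK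
    apply alt_swap N (s G).1 hi
    · unfold rho; omega
    · unfold rho; omega
    · intro l h1 h2
      rw [toggle_wt_ne l h1 h2]
  refine Finset.sum_involution (fun G _ => toggle (s G).1 (s G).2.1 (s G).2.2 G) hzero ?_ hmem' ?_
  · intro G hG hne heq
    have := hzero G hG
    rw [heq] at this
    exact hne (add_self_eq_zero.1 this)
  · intro G hG
    have hu := (hnew G hG).unique (toggle_isGT ((hmem G).1 hG).1 (hs G hG).hi) (hs _ (hmem' G hG))
    rw [hu.1, hu.2.1, hu.2.2]
    exact toggle_toggle ((hmem G).1 hG).1 (hs G hG).hi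

def cut (N : ℕ) (w : ℕ → ℕ) : ℕ → ℕ := fun l => if l < N then w l else 0

open Classical in
theorem LR (N k : ℕ) (lam mu : ℕ → ℕ) (hl : Antitone lam) (h0 : ∀ j, k ≤ j → lam j = 0)
    (hm : Antitone mu) (hm0 : ∀ j, k ≤ j → mu j = 0) :
    JT (xv N) N k lam * JT (xv N) N k mu =
      ∑ G ∈ (GTs 2 N (sh (fun _ => 0) (ind k)) (sh lam (fun r => mu r + ind k r))).filter
        (fun G => Good N (2*k) G), JT (xv N) N N (cut N (wt (2*k) G)) := by
  have hK : ∀ q, 2*k ≤ q → sh lam (fun r => mu r + ind k r) q = 0 := by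
    intro q hq
    have : k ≤ q / 2 := by omega
    unfold sh ind
    simp [h0 _ this, hm0 _ this]
    intros; omega
  apply mul_left_cancel₀ (alt_rho_ne N)
  rw [alt_mul_symm N _ (fun G => wt (2*k) G) _ (JT_mul_eq_sum (xv N) N k lam mu hl h0 hm hm0)]
  · rw [sum_good _ _ _ _ hK, Finset.mul_sum]
    apply Finset.sum_congr rfl
    intro G _
    rw [← bialternant]
    unfold alt
    congr 1
    ext1 a j
    simp [cut]
  · intro σ
    rw [map_mul, rename_JT, rename_JT]

end SLC

namespace SLC
open Finset MvPolynomial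

/-- the cone of Schur nonnegative polynomials -/
noncomputable def PP (N : ℕ) : AddSubmonoid (MvPolynomial (Fin N) ℤ) :=
  AddSubmonoid.closure {f | ∃ k lam, Antitone lam ∧ (∀ j, k ≤ j → lam j = 0) ∧ f = JT (xv N) N k lam}

lemma JT_mem (N k : ℕ) (lam : ℕ → ℕ) (hl : Antitone lam) (h0 : ∀ j, k ≤ j → lam j = 0) :
    JT (xv N) N k lam ∈ PP N := AddSubmonoid.subset_closure ⟨k, lam, hl, h0, rfl⟩

lemma PP_isSchurNonneg (N : ℕ) {f} (hf : f ∈ PP N) : IsSchurNonneg N f := by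
  induction hf using AddSubmonoid.closure_induction with
  | mem f h =>
    obtain ⟨k, lam, hl, h0, rfl⟩ := h
    refine ⟨1, fun _ => 1, fun _ => k, fun _ => lam, fun _ => hl, fun _ => h0, ?_⟩
    simp [skewSchur_eq]
  | zero => exact ⟨0, fun _ => 0, fun _ => 0, fun _ _ => 0, fun i => i.elim0, fun i => i.elim0, by simp⟩
  | add f g _ _ hf hg =>
    obtain ⟨m1, c1, k1, l1, a1, b1, rfl⟩ := hf
    obtain ⟨m2, c2, k2, l2, a2, b2, rfl⟩ := hg
    refine ⟨m1 + m2, Fin.append c1 c2, Fin.append k1 k2, Fin.append l1 l2, ?_, ?_, ?_⟩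
    · intro i
      refine Fin.addCases (fun i => ?_) (fun i => ?_) i
      · rw [Fin.append_left]; exact a1 i
      · rw [Fin.append_right]; exact a2 i
    · intro i
      refine Fin.addCases (fun i => ?_) (fun i => ?_) i
      · rw [Fin.append_left, Fin.append_left]; exact b1 i
      · rw [Fin.append_right, Fin.append_right]; exact b2 i
    · rw [Fin.sum_univ_add]
      simp only [Fin.append_left, Fin.append_right]

lemma JT_pad {R : Type*} [CommRing R] (x : ℕ → R) (N k k' : ℕ) (hk : k ≤ k') (lam : ℕ → ℕ)
    (hl : Antitone lam) (h0 : ∀ j, k ≤ j → lam j = 0) : JT x N k lam = JT x N k' lam := by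
  rw [JT_eq_sum x N k lam hl h0, JT_eq_sum x N k' lam hl (fun j hj => h0 j (by omega))]
  apply Finset.sum_congr rfl
  intro G hG
  rw [mem_GTs (K := k) h0] at hG
  apply Finset.prod_congr rfl
  intro l _
  congr 1
  unfold wt
  apply Finset.sum_subset
  · intro q hq; simp at hq ⊢; omega
  · intro q _ hq
    have : k ≤ q := by simpa using hq
    rw [hG.row_zero (h0 q this)]; simp

lemma cut_antitone {N K p : ℕ} {inn out : ℕ → ℕ} {G : ℕ → ℕ → ℕ} (h : Good N K G) (hG : IsGT p N inn out G) :
    Antitone (cut N (wt K G)) := by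
  apply antitone_nat_of_succ_le
  intro l
  have := h.wt_antitone hG l
  unfold cut
  split_ifs <;> first | omega | exact this (by omega)

lemma JT_cut_mem {N K p : ℕ} {inn out : ℕ → ℕ} {G : ℕ → ℕ → ℕ} (h : Good N K G) (hG : IsGT p N inn out G) :
    JT (xv N) N N (cut N (wt K G)) ∈ PP N := by
  apply JT_mem _ _ _ (cut_antitone h hG)
  intro j hj
  simp [cut, not_lt.2 hj]

lemma shK {k : ℕ} {lam mu : ℕ → ℕ} (h0 : ∀ j, k ≤ j → lam j = 0) (hm0 : ∀ j, k ≤ j → mu j = 0) :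
    ∀ q, 2*k ≤ q → sh lam (fun r => mu r + ind k r) q = 0 := by
  intro q hq
  have : k ≤ q / 2 := by omega
  unfold sh ind
  simp [h0 _ this, hm0 _ this]
  intros; omega

lemma JT_mul_mem (N k : ℕ) (lam mu : ℕ → ℕ) (hl : Antitone lam) (h0 : ∀ j, k ≤ j → lam j = 0)
    (hm : Antitone mu) (hm0 : ∀ j, k ≤ j → mu j = 0) :
    JT (xv N) N k lam * JT (xv N) N k mu ∈ PP N := by
  classical
  rw [LR N k lam mu hl h0 hm hm0]
  apply AddSubmonoid.sum_mem
  intro G hG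
  rw [Finset.mem_filter, mem_GTs (K := 2*k) (shK h0 hm0)] at hG
  exact JT_cut_mem hG.2 hG.1

lemma PP_mul (N : ℕ) {f g} (hf : f ∈ PP N) (hg : g ∈ PP N) : f * g ∈ PP N := by
  induction hf using AddSubmonoid.closure_induction with
  | mem f h =>
    obtain ⟨k, lam, hl, h0, rfl⟩ := h
    induction hg using AddSubmonoid.closure_induction with
    | mem g h =>
      obtain ⟨k', mu, hm, hm0, rfl⟩ := h
      rw [JT_pad _ _ k (max k k') (le_max_left _ _) lam hl h0, JT_pad _ _ k' (max k k') (le_max_right _ _) mu hm hm0]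
      exact JT_mul_mem _ _ _ _ hl (fun j hj => h0 j (by omega)) hm (fun j hj => hm0 j (by omega))
    | zero => rw [mul_zero]; exact zero_mem _
    | add a b _ _ ha hb => rw [mul_add]; exact add_mem ha hb
  | zero => rw [zero_mul]; exact zero_mem _
  | add a b _ _ ha hb => rw [add_mul]; exact add_mem ha hb

lemma PP_one (N : ℕ) : (1 : MvPolynomial (Fin N) ℤ) ∈ PP N := by
  have := JT_mem N 0 (fun _ => 0) (fun _ _ _ => le_rfl) (fun _ _ => rfl)
  simpa [JT] using this

lemma PP_prod (N : ℕ) {ι : Type*} (s : Finset ι) (f : ι → MvPolynomial (Fin N) ℤ) (h : ∀ i ∈ s, f i ∈ PP N) :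
    ∏ i ∈ s, f i ∈ PP N :=
  Finset.prod_induction f (· ∈ PP N) (fun _ _ ha hb => PP_mul N ha hb) (PP_one N) h

def up (lam mu : ℕ → ℕ) : ℕ → ℕ := fun i => max (lam i - 1) (mu i)
def dn (lam mu : ℕ → ℕ) : ℕ → ℕ := fun i => min (lam i) (mu i + 1)

lemma up_antitone {lam mu : ℕ → ℕ} (hl : Antitone lam) (hm : Antitone mu) : Antitone (up lam mu) := by
  intro a b h
  have := hl h
  have := hm h
  unfold up
  omega

lemma dn_antitone {lam mu : ℕ → ℕ} (hl : Antitone lam) (hm : Antitone mu) : Antitone (dn lam mu) := by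
  intro a b h
  have := hl h
  have := hm h
  unfold dn
  omega

theorem key_ineq (N k : ℕ) (lam mu : ℕ → ℕ) (hl : Antitone lam) (h0 : ∀ j, k ≤ j → lam j = 0)
    (hm : Antitone mu) (hm0 : ∀ j, k ≤ j → mu j = 0) :
    JT (xv N) N k (up lam mu) * JT (xv N) N k (dn lam mu)
      - JT (xv N) N k lam * JT (xv N) N k mu ∈ PP N := by
  classical
  have u0 : ∀ j, k ≤ j → up lam mu j = 0 := by
    intro j hj; simp [up, h0 j hj, hm0 j hj]
  have d0 : ∀ j, k ≤ j → dn lam mu j = 0 := by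
    intro j hj; simp [dn, h0 j hj]
  rw [mul_comm (JT (xv N) N k (up lam mu)), LR N k lam mu hl h0 hm hm0,
    LR N k (dn lam mu) (up lam mu) (dn_antitone hl hm) d0 (up_antitone hl hm) u0]
  have hout : sh (dn lam mu) (fun r => up lam mu r + ind k r)
      = sh (fun r => min (lam r) (mu r + ind k r)) (fun r => max (lam r) (mu r + ind k r)) := by
    congr 1
    · funext r
      by_cases hr : r < k
      · simp [dn, ind, hr]
      · simp [dn, h0 r (by omega)]
    · funext r
      by_cases hr : r < k
      · simp only [up, ind, hr, if_true]; omega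
      · simp [up, h0 r (by omega), ind, hr]
  set S := (GTs 2 N (sh (fun _ => 0) (ind k)) (sh lam (fun r => mu r + ind k r))).filter
        (fun G => Good N (2*k) G) with hS
  set S' := (GTs 2 N (sh (fun _ => 0) (ind k)) (sh (dn lam mu) (fun r => up lam mu r + ind k r))).filter
        (fun G => Good N (2*k) G) with hS'
  have mS : ∀ G, G ∈ S ↔ IsGT 2 N (sh (fun _ => 0) (ind k)) (sh lam (fun r => mu r + ind k r)) G ∧ Good N (2*k) G := by
    intro G
    rw [hS, Finset.mem_filter, mem_GTs (K := 2*k) (shK h0 hm0)]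
  have mS' : ∀ G, G ∈ S' ↔ IsGT 2 N (sh (fun _ => 0) (ind k)) (sh (dn lam mu) (fun r => up lam mu r + ind k r)) G ∧ Good N (2*k) G := by
    intro G
    rw [hS', Finset.mem_filter, mem_GTs (K := 2*k) (shK d0 u0)]
  let Φ := Phi N lam (fun r => mu r + ind k r)
  have hinj : Set.InjOn Φ S := by
    intro G hG G' hG' h
    have h1 := Phi_Phi ((mS G).1 hG).1
    have h2 := Phi_Phi ((mS G').1 hG').1
    change Phi _ _ _ (Φ G) = G at h1
    change Phi _ _ _ (Φ G') = G' at h2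
    rw [← h1, ← h2, h]
  have hsub : S.image Φ ⊆ S' := by
    intro G' hG'
    obtain ⟨G, hG, rfl⟩ := Finset.mem_image.1 hG'
    rw [mS] at hG
    rw [mS', hout]
    exact ⟨Phi_isGT hG.1, Phi_good hG.1 hG.2⟩
  have hsum : ∑ G ∈ S, JT (xv N) N N (cut N (wt (2*k) G)) = ∑ G ∈ S.image Φ, JT (xv N) N N (cut N (wt (2*k) G)) := by
    rw [Finset.sum_image hinj]
    apply Finset.sum_congr rfl
    intro G hG
    have : wt (2*k) (Φ G) = wt (2*k) G := by
      funext l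
      exact Phi_wt ((mS G).1 hG).1 l
    rw [this]
  rw [hsum, ← Finset.sum_sdiff hsub, add_sub_cancel_right]
  apply AddSubmonoid.sum_mem
  intro G hG
  have := (mS' G).1 (Finset.mem_sdiff.1 hG).1
  exact JT_cut_mem this.2 this.1

theorem family (N k : ℕ) {ι : Type*} [Fintype ι] [DecidableEq ι] (nu : ℕ → ℕ) :
    ∀ (w : ℕ) (P : ι → ℕ → ℕ), (∑ j, ∑ i ∈ range k, P j i ^ 2 = w) → (∀ j, Antitone (P j)) →
    (∀ j q, k ≤ q → P j q = 0) → (∀ i, ∑ j, P j i = Fintype.card ι * nu i) →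
    JT (xv N) N k nu ^ Fintype.card ι - ∏ j, JT (xv N) N k (P j) ∈ PP N := by
  intro w
  induction w using Nat.strong_induction_on with
  | _ w ih =>
  intro P hw hP hP0 hsum
  by_cases hall : ∀ j1 j2 i, P j1 i ≤ P j2 i + 1
  · have heq : ∀ j, P j = nu := by
      intro j
      funext i
      rcases Nat.lt_trichotomy (P j i) (nu i) with h | h | h
      · exfalso
        have : ∑ j, P j i < ∑ _j : ι, nu i := by
          apply Finset.sum_lt_sum
          · intro j' _
            have := hall j' j i
            omega
          · exact ⟨j, mem_univ _, h⟩
        rw [hsum] at this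
        simp at this
      · exact h
      · exfalso
        have : ∑ _j : ι, nu i < ∑ j, P j i := by
          apply Finset.sum_lt_sum
          · intro j' _
            have := hall j j' i
            omega
          · exact ⟨j, mem_univ _, h⟩
        rw [hsum] at this
        simp at this
    have : ∏ j, JT (xv N) N k (P j) = JT (xv N) N k nu ^ Fintype.card ι := by
      simp only [heq, Finset.prod_const, Finset.card_univ]
    rw [this, sub_self]
    exact zero_mem _
  · push Not at hall
    obtain ⟨j1, j2, i0, hlt⟩ := hall
    have hne : j2 ≠ j1 := by
      rintro rfl
      omega
    have hi0 : i0 < k := by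
      by_contra h
      have := hP0 j1 i0 (by omega)
      omega
    let P' : ι → ℕ → ℕ := fun j => if j = j1 then up (P j1) (P j2) else if j = j2 then dn (P j1) (P j2) else P j
    have p1 : P' j1 = up (P j1) (P j2) := by simp [P']
    have p2 : P' j2 = dn (P j1) (P j2) := by simp [P', hne]
    have p3 : ∀ j ∈ (univ.erase j1).erase j2, P' j = P j := by
      intro j hj
      simp only [mem_erase] at hj
      simp [P', hj.1, hj.2.1]
    have hm2 : j2 ∈ univ.erase j1 := by simp [hne]
    have split_sum : ∀ {M : Type} [AddCommMonoid M] (f : ι → M), ∑ j, f j = f j1 + (f j2 + ∑ j ∈ (univ.erase j1).erase j2, f j) := by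
      intro M _ f
      rw [← Finset.add_sum_erase univ f (mem_univ j1), ← Finset.add_sum_erase _ f hm2]
    have split_prod : ∀ (f : ι → MvPolynomial (Fin N) ℤ), ∏ j, f j = f j1 * (f j2 * ∏ j ∈ (univ.erase j1).erase j2, f j) := by
      intro f
      rw [← Finset.mul_prod_erase univ f (mem_univ j1), ← Finset.mul_prod_erase _ f hm2]
    have hP' : ∀ j, Antitone (P' j) := by
      intro j
      simp only [P']
      split_ifs
      · exact up_antitone (hP _) (hP _)
      · exact dn_antitone (hP _) (hP _)
      · exact hP j
    have hP'0 : ∀ j q, k ≤ q → P' j q = 0 := by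
      intro j q hq
      have h1 := hP0 j1 q hq
      have h2 := hP0 j2 q hq
      simp only [P']
      split_ifs
      · simp [up, h1, h2]
      · simp [dn, h1]
      · exact hP0 j q hq
    have hsum' : ∀ i, ∑ j, P' j i = Fintype.card ι * nu i := by
      intro i
      rw [← hsum, split_sum, split_sum (fun j => P j i), p1, p2,
        Finset.sum_congr rfl (fun j hj => by rw [p3 j hj])]
      simp only [up, dn]
      omega
    have hsq : ∀ a b : ℕ, (max (a-1) b)^2 + (min a (b+1))^2 ≤ a^2 + b^2 ∧
        (b + 1 < a → (max (a-1) b)^2 + (min a (b+1))^2 < a^2 + b^2) := by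
      intro a b
      rcases Nat.lt_or_ge b a with h | h
      · obtain ⟨d, rfl⟩ : ∃ d, a = b + 1 + d := ⟨a - b - 1, by omega⟩
        rw [max_eq_left (by omega), min_eq_right (by omega), show b + 1 + d - 1 = b + d by omega]
        constructor
        · nlinarith
        · intro h
          nlinarith
      · rw [max_eq_right (by omega), min_eq_left (by omega)]
        constructor
        · omega
        · intro; omega
    have hw' : ∑ j, ∑ i ∈ range k, P' j i ^ 2 < w := by
      have e : ∑ j ∈ (univ.erase j1).erase j2, ∑ i ∈ range k, P' j i ^ 2
          = ∑ j ∈ (univ.erase j1).erase j2, ∑ i ∈ range k, P j i ^ 2 :=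
        Finset.sum_congr rfl (fun j hj => by rw [p3 j hj])
      rw [← hw, split_sum, split_sum (fun j => ∑ i ∈ range k, P j i ^ 2), p1, p2, e, ← add_assoc, ← add_assoc,
        ← Finset.sum_add_distrib, ← Finset.sum_add_distrib]
      apply Nat.add_lt_add_right
      apply Finset.sum_lt_sum
      · intro i _
        exact (hsq (P j1 i) (P j2 i)).1
      · exact ⟨i0, mem_range.2 hi0, (hsq (P j1 i0) (P j2 i0)).2 hlt⟩
    have hrec := ih _ hw' P' rfl hP' hP'0 hsum'
    have hstep : ∏ j, JT (xv N) N k (P' j) - ∏ j, JT (xv N) N k (P j) ∈ PP N := by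
      rw [split_prod, split_prod (fun j => JT (xv N) N k (P j)), p1, p2,
        Finset.prod_congr rfl (fun j hj => by rw [p3 j hj]), ← mul_assoc, ← mul_assoc, ← sub_mul]
      apply PP_mul
      · exact key_ineq N k _ _ (hP j1) (hP0 j1) (hP j2) (hP0 j2)
      · apply PP_prod
        intro j _
        exact JT_mem _ _ _ (hP j) (hP0 j)
    have := add_mem hrec hstep
    rwa [sub_add_sub_cancel] at this

end SLC

/-- **Schur log-concavity.** For positive integers `c, d` and partitions `λ, μ`
(with at most `k` parts) such that `ν := (cλ + dμ)/(c+d)` is a partition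
(i.e. all parts of `cλ + dμ` are divisible by `c + d`),
`(s_ν)^{c+d} ≥_s (s_λ)^c (s_μ)^d`. -/
theorem schur_log_concavity (c d : ℕ) (hc : 1 ≤ c) (hd : 1 ≤ d)
    (k : ℕ) (lam mu : ℕ → ℕ) (hlam : Antitone lam) (hmu : Antitone mu)
    (hlamk : ∀ j, k ≤ j → lam j = 0) (hmuk : ∀ j, k ≤ j → mu j = 0)
    (hdvd : ∀ i, (c + d) ∣ (c * lam i + d * mu i))
    (N : ℕ) :
    IsSchurNonneg N
      (skewSchur N k (fun i => (c * lam i + d * mu i) / (c + d)) (fun _ => 0) ^ (c + d)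
        - skewSchur N k lam (fun _ => 0) ^ c * skewSchur N k mu (fun _ => 0) ^ d) := by
  apply SLC.PP_isSchurNonneg
  simp only [SLC.skewSchur_eq]
  have h := SLC.family N k (ι := Fin c ⊕ Fin d) (fun i => (c * lam i + d * mu i) / (c + d)) _
    (fun j => Sum.elim (fun _ => lam) (fun _ => mu) j) rfl
    (by rintro (j | j); exacts [hlam, hmu])
    (by rintro (j | j); exacts [hlamk, hmuk])
    (by
      intro i
      simp only [Fintype.sum_sum_type, Sum.elim_inl, Sum.elim_inr, Finset.sum_const,
        Finset.card_univ, Fintype.card_fin, Fintype.card_sum, smul_eq_mul]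
      rw [Nat.mul_div_cancel' (hdvd i)])
  simpa only [Fintype.prod_sum_type, Sum.elim_inl, Sum.elim_inr, Finset.prod_const,
        Finset.card_univ, Fintype.card_fin, Fintype.card_sum] using h
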